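/- arXiv:2206.02589 — 12 statements merged into one kernel-verified Lean document; each statement's English description precedes it below -/
import Mathlib

section
/- Let n > 1 be an odd integer, and let ζ ∈ ℂ be a primitive n-th root of unity. For j, k = 1, ..., n-1 define a_{jk} = (1 + ζ^{j-k})/(1 - ζ^{j-k}) if j ≠ k, and a_{jj} = 0. Then for every complex number x, det[x + a_{jk}]_{1 ≤ j,k ≤ n-1} = (-1)^{(n-1)/2} ((n-2)!!)^2 / n. -/
open scoped Nat

/-- A closed form for `∑ (c - 2 m) z ^ m`, multiplied by `1 - z`. -/
theorem one_sub_mul_sum_sub_two_mul (N : ℕ) (c z : ℂ) :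
    (1 - z) * ∑ m ∈ Finset.range N, (c - 2 * (m + 1)) * z ^ (m + 1) =
      c * z - (c - 2 * N) * z ^ (N + 1) - 2 * z * ∑ m ∈ Finset.range N, z ^ m := by
  induction N with
  | zero => simp
  | succ N ih =>
    rw [Finset.sum_range_succ, Finset.sum_range_succ, mul_add, ih]
    push_cast
    ring

theorem sum_sub_two_mul_mul_pow_eq {N : ℕ} {z : ℂ} (hz : z ^ (N + 1) = 1) (hz1 : z ≠ 1) :
    ∑ m ∈ Finset.range N, (((N + 1 : ℕ) : ℂ) - 2 * (m + 1)) * z ^ (m + 1) =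
      (N + 1 : ℕ) * ((1 + z) / (1 - z)) := by
  have h1 : 1 - z ≠ 0 := sub_ne_zero.2 hz1.symm
  have hg : (1 - z) * ∑ m ∈ Finset.range N, z ^ m = 1 - z ^ N := mul_neg_geom_sum z N
  have hzz : z * ∑ m ∈ Finset.range N, z ^ m = -1 := by
    apply mul_left_cancel₀ h1
    rw [mul_left_comm, hg]
    linear_combination -hz
  have h := one_sub_mul_sum_sub_two_mul N ((N + 1 : ℕ) : ℂ) z
  apply mul_left_cancel₀ h1
  rw [h, hz, mul_assoc, hzz]
  field_simp
  push_cast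
  ring

theorem sum_sub_two_mul_eq_zero (N : ℕ) :
    ∑ m ∈ Finset.range N, (((N + 1 : ℕ) : ℂ) - 2 * (m + 1)) = 0 := by
  have h : ∀ (c : ℂ) (M : ℕ), ∑ m ∈ Finset.range M, (c - 2 * (m + 1)) = M * (c - (M + 1)) := by
    intro c M
    induction M with
    | zero => simp
    | succ M ih =>
      rw [Finset.sum_range_succ, ih]
      push_cast
      ring
  rw [h]
  push_cast
  ring

theorem prod_two_mul_add_one_eq_doubleFactorial (k : ℕ) :
    ∏ m ∈ Finset.range (k + 1), (2 * (m : ℂ) + 1) = ((2 * k + 1)‼ : ℂ) := by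
  induction k with
  | zero => simp
  | succ k ih =>
    rw [Finset.prod_range_succ, ih, show 2 * (k + 1) + 1 = (2 * k + 1) + 2 by ring,
      Nat.doubleFactorial_add_two]
    push_cast
    ring

theorem prod_sub_two_mul_eq (k : ℕ) :
    ∏ m ∈ Finset.range (k + 1 + (k + 1)),
        (((k + 1 + (k + 1) + 1 : ℕ) : ℂ) - 2 * (m + 1)) =
      (-1) ^ (k + 1) * ((2 * k + 1)‼ : ℂ) ^ 2 := by
  rw [Finset.prod_range_add, ← Finset.prod_range_reflect]
  have h1 : ∀ m ∈ Finset.range (k + 1),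
      (((k + 1 + (k + 1) + 1 : ℕ) : ℂ) - 2 * (((k + 1 - 1 - m : ℕ) : ℂ) + 1)) = 2 * m + 1 := by
    intro m hm
    have : m ≤ k := Nat.lt_succ_iff.1 (Finset.mem_range.1 hm)
    rw [Nat.add_sub_cancel, Nat.cast_sub this]
    push_cast
    ring
  have h2 : ∀ m ∈ Finset.range (k + 1),
      (((k + 1 + (k + 1) + 1 : ℕ) : ℂ) - 2 * (((k + 1 + m : ℕ) : ℂ) + 1)) =
        (-1) * (2 * m + 1) := by
    intro m _
    push_cast
    ring
  rw [Finset.prod_congr rfl h1, Finset.prod_congr rfl h2, Finset.prod_mul_distrib,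
    prod_two_mul_add_one_eq_doubleFactorial]
  simp
  ring

/-- The determinant of a skew-symmetric matrix of even size does not change when the same constant
is added to all entries. -/
theorem Matrix.det_of_const_add_of_skew {ι : Type*} [Fintype ι] [DecidableEq ι]
    (A : Matrix ι ι ℂ) (hA : A.transpose = -A) (hc : Even (Fintype.card ι))
    (hdet : A.det ≠ 0) (x : ℂ) :
    (Matrix.of fun j k => x + A j k).det = A.det := by
  have haff : ∀ y : ℂ, (Matrix.of fun j k => y + A j k).det =
      A.det * (1 + y * ∑ i, ∑ j, A⁻¹ i j) := by
    intro y
    have h : (Matrix.of fun j k => y + A j k) =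
        A + Matrix.replicateCol Unit (fun _ => y) * Matrix.replicateRow Unit (fun _ => (1 : ℂ)) := by
      ext j k
      simp [Matrix.mul_apply, add_comm]
    rw [h, Matrix.det_add_replicateCol_mul_replicateRow (isUnit_iff_ne_zero.2 hdet)]
    congr 1
    rw [Matrix.det_unique]
    simp [Matrix.mul_apply, ← Finset.sum_mul, mul_comm y]
    exact Or.inl Finset.sum_comm
  have hsymm : (Matrix.of fun j k => x + A j k).det = (Matrix.of fun j k => -x + A j k).det := by
    have h : (Matrix.of fun j k => x + A j k).transpose = -(Matrix.of fun j k => -x + A j k) := by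
      ext j k
      have := congrFun (congrFun hA j) k
      simp only [Matrix.transpose_apply, Matrix.neg_apply] at this
      simp [this]
      ring
    rw [← Matrix.det_transpose, h, Matrix.det_neg, hc.neg_one_pow, one_mul]
  rw [haff, haff] at hsymm
  rw [haff]
  linear_combination hsymm / 2

theorem det_smul_one_sub_const (N : ℕ) :
    (Matrix.of fun j k : Fin N => (if j = k then ((N + 1 : ℕ) : ℂ) else 0) - 1).det *
      (N + 1 : ℕ) = ((N + 1 : ℕ) : ℂ) ^ N := by
  have hn : ((N + 1 : ℕ) : ℂ) ≠ 0 := Nat.cast_ne_zero.2 N.succ_ne_zero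
  have h : (Matrix.of fun j k : Fin N => (if j = k then ((N + 1 : ℕ) : ℂ) else 0) - 1) =
      ((N + 1 : ℕ) : ℂ) • (1 + Matrix.replicateCol Unit (fun _ => -((N + 1 : ℕ) : ℂ)⁻¹) *
        Matrix.replicateRow Unit (fun _ => (1 : ℂ))) := by
    ext j k
    simp only [Matrix.of_apply, Matrix.smul_apply, Matrix.add_apply, Matrix.mul_apply,
      Matrix.one_apply, Matrix.replicateCol_apply, Matrix.replicateRow_apply, smul_eq_mul]
    split_ifs <;> simp [mul_add, hn, sub_eq_add_neg, -Nat.cast_add]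
  rw [h, Matrix.det_smul, Matrix.det_one_add_replicateCol_mul_replicateRow]
  simp only [dotProduct, Finset.sum_const, Finset.card_univ, Fintype.card_fin, one_mul,
    nsmul_eq_mul]
  rw [mul_assoc, add_mul, mul_assoc, neg_mul, inv_mul_cancel₀ hn]
  push_cast
  ring

/-- The matrix with entries `(1 + ζ ^ (j - k)) / (1 - ζ ^ (j - k))` off the diagonal and `0` on it. -/
noncomputable def cotangentMatrix (N : ℕ) (ζ : ℂ) : Matrix (Fin N) (Fin N) ℂ :=
  Matrix.of fun j k => if j = k then 0 else
    (1 + ζ ^ ((j : ℤ) - (k : ℤ))) / (1 - ζ ^ ((j : ℤ) - (k : ℤ)))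

section

variable {N : ℕ} {ζ : ℂ}

theorem zpow_pow_eq_one_of_primitive (hζ : IsPrimitiveRoot ζ (N + 1)) (a : ℤ) :
    (ζ ^ a) ^ (N + 1) = 1 := by
  rw [← zpow_natCast, ← zpow_mul, mul_comm, zpow_mul, zpow_natCast, hζ.pow_eq_one, one_zpow]

theorem zpow_sub_ne_one (hζ : IsPrimitiveRoot ζ (N + 1)) {j k : Fin N} (h : j ≠ k) :
    ζ ^ ((j : ℤ) - (k : ℤ)) ≠ 1 := by
  rw [Ne, hζ.zpow_eq_one_iff_dvd]
  intro hd
  have h0 := Int.eq_zero_of_abs_lt_dvd hd (by rw [abs_lt]; omega)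
  exact h (Fin.ext (by omega))

theorem pow_mul_zpow_neg (hζ : ζ ≠ 0) (j k m : ℕ) :
    ζ ^ (j * (m + 1)) * ζ ^ (-((k * (m + 1) : ℕ) : ℤ)) = (ζ ^ ((j : ℤ) - (k : ℤ))) ^ (m + 1) := by
  rw [← zpow_natCast, ← zpow_add₀ hζ, ← zpow_natCast, ← zpow_mul]
  congr 1
  push_cast
  ring

theorem cotangentMatrix_transpose (hζ : IsPrimitiveRoot ζ (N + 1)) :
    (cotangentMatrix N ζ).transpose = -cotangentMatrix N ζ := by
  ext j k
  simp only [cotangentMatrix, Matrix.transpose_apply, Matrix.neg_apply, Matrix.of_apply]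
  by_cases h : j = k
  · simp [h]
  rw [if_neg (Ne.symm h), if_neg h]
  have h1 := zpow_sub_ne_one hζ h
  have h0 : ζ ^ ((j : ℤ) - (k : ℤ)) ≠ 0 := zpow_ne_zero _ (hζ.ne_zero N.succ_ne_zero)
  rw [← neg_sub (j : ℤ) (k : ℤ), zpow_neg]
  generalize ζ ^ ((j : ℤ) - (k : ℤ)) = z at h0 h1
  have h2 : 1 - z ≠ 0 := sub_ne_zero.2 h1.symm
  have h3 : 1 - z⁻¹ ≠ 0 := sub_ne_zero.2 (by simpa [eq_comm] using h1)
  rw [← neg_div, div_eq_div_iff h3 h2]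
  field_simp
  ring

theorem cotangentMatrix_det_mul (hζ : IsPrimitiveRoot ζ (N + 1)) :
    (cotangentMatrix N ζ).det * (N + 1 : ℕ) =
      ∏ m ∈ Finset.range N, (((N + 1 : ℕ) : ℂ) - 2 * (m + 1)) := by
  have hn : ((N + 1 : ℕ) : ℂ) ≠ 0 := Nat.cast_ne_zero.2 N.succ_ne_zero
  have hζ0 := hζ.ne_zero N.succ_ne_zero
  let F : Matrix (Fin N) (Fin N) ℂ := Matrix.of fun j m => ζ ^ ((j : ℕ) * (m + 1))
  let G : Matrix (Fin N) (Fin N) ℂ := Matrix.of fun m k => ζ ^ (-(((k : ℕ) * (m + 1) : ℕ) : ℤ))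
  let d : Fin N → ℂ := fun m => ((N + 1 : ℕ) : ℂ) - 2 * ((m : ℕ) + 1)
  have hFG : F * G =
      Matrix.of fun j k : Fin N => (if j = k then ((N + 1 : ℕ) : ℂ) else 0) - 1 := by
    ext j k
    simp only [F, G, Matrix.mul_apply, Matrix.of_apply, pow_mul_zpow_neg hζ0]
    rw [Fin.sum_univ_eq_sum_range (fun m => (ζ ^ ((j : ℤ) - (k : ℤ))) ^ (m + 1)) N]
    by_cases h : j = k
    · simp [h]
    rw [if_neg h]
    have h1 := zpow_sub_ne_one hζ h
    have h2 := mul_neg_geom_sum (ζ ^ ((j : ℤ) - (k : ℤ))) (N + 1)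
    rw [zpow_pow_eq_one_of_primitive hζ, sub_self, Finset.sum_range_succ', pow_zero] at h2
    have h3 := (mul_eq_zero.1 h2).resolve_left (sub_ne_zero.2 h1.symm)
    linear_combination h3
  have hFDG : F * Matrix.diagonal d * G = ((N + 1 : ℕ) : ℂ) • cotangentMatrix N ζ := by
    ext j k
    rw [Matrix.mul_apply]
    simp only [Matrix.mul_diagonal, Matrix.smul_apply, cotangentMatrix, Matrix.of_apply,
      smul_eq_mul, F, G, d, mul_right_comm _ (_ - _ : ℂ), pow_mul_zpow_neg hζ0]
    simp only [mul_comm (_ ^ _ : ℂ) (_ - _)]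
    rw [Fin.sum_univ_eq_sum_range (fun m => (((N + 1 : ℕ) : ℂ) - 2 * ((m : ℂ) + 1)) *
      (ζ ^ ((j : ℤ) - (k : ℤ))) ^ (m + 1)) N]
    by_cases h : j = k
    · have := sum_sub_two_mul_eq_zero N
      simpa [h] using this
    rw [if_neg h]
    exact sum_sub_two_mul_mul_pow_eq (zpow_pow_eq_one_of_primitive hζ _) (zpow_sub_ne_one hζ h)
  have h1 := congrArg Matrix.det hFDG
  rw [Matrix.det_mul, Matrix.det_mul, Matrix.det_diagonal, Matrix.det_smul, Fintype.card_fin] at h1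
  have h2 := det_smul_one_sub_const N
  rw [← hFG, Matrix.det_mul] at h2
  have hd : ∏ m, d m = ∏ m ∈ Finset.range N, (((N + 1 : ℕ) : ℂ) - 2 * (m + 1)) :=
    Fin.prod_univ_eq_prod_range (fun m : ℕ => ((N + 1 : ℕ) : ℂ) - 2 * ((m : ℂ) + 1)) N
  rw [← hd]
  apply mul_left_cancel₀ (pow_ne_zero N hn)
  linear_combination (∏ m, d m) * h2 - ((N + 1 : ℕ) : ℂ) * h1

end

theorem stmt_0 (n : ℕ) (hn : 1 < n) (hodd : Odd n) (ζ : ℂ)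
    (hζ : IsPrimitiveRoot ζ n) (x : ℂ) :
    Matrix.det (Matrix.of fun j k : Fin (n - 1) =>
      x + if j = k then 0 else
        (1 + ζ ^ ((j : ℤ) - (k : ℤ))) / (1 - ζ ^ ((j : ℤ) - (k : ℤ)))) =
    (-1) ^ ((n - 1) / 2) * ((n - 2)‼ : ℂ) ^ 2 / n := by
  obtain ⟨k, rfl⟩ : ∃ k, n = k + 1 + (k + 1) + 1 := by
    obtain ⟨r, hr⟩ := hodd
    exact ⟨r - 1, by omega⟩
  have hn0 : ((k + 1 + (k + 1) + 1 : ℕ) : ℂ) ≠ 0 := Nat.cast_ne_zero.2 (Nat.succ_ne_zero _)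
  have hdet := cotangentMatrix_det_mul hζ
  rw [prod_sub_two_mul_eq] at hdet
  have hne : (cotangentMatrix (k + 1 + (k + 1)) ζ).det ≠ 0 := by
    intro h0
    rw [h0, zero_mul] at hdet
    have : ((2 * k + 1)‼ : ℂ) ≠ 0 := Nat.cast_ne_zero.2 (Nat.doubleFactorial_pos _).ne'
    exact mul_ne_zero (pow_ne_zero _ (by norm_num)) (pow_ne_zero _ this) hdet.symm
  have hx := Matrix.det_of_const_add_of_skew _ (cotangentMatrix_transpose hζ)
    (by rw [Fintype.card_fin]; exact ⟨_, rfl⟩) hne x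
  rw [show (k + 1 + (k + 1) + 1 - 1) / 2 = k + 1 by omega,
    show k + 1 + (k + 1) + 1 - 2 = 2 * k + 1 by omega, eq_div_iff hn0, ← hdet, ← hx]
  rfl
end

section
/- Let n > 1 be an odd integer, and let ζ ∈ ℂ be a primitive n-th root of unity. Then ∑_{τ ∈ D(n-1)} sign(τ) ∏_{j=1}^{n-1} (1 + ζ^{j-τ(j)})/(1 - ζ^{j-τ(j)}) = (-1)^{(n-1)/2} ((n-2)!!)^2 / n, where D(n-1) is the set of all derangements of 1, ..., n-1. -/
open scoped Nat

open Polynomial Matrix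

/-- A sum over all `n`-th roots of unity, split into the term at `1` and the nontrivial powers of
a primitive root. -/
lemma IsPrimitiveRoot.sum_nthRootsFinset_succ {R M : Type*} [CommRing R] [IsDomain R]
    [AddCommMonoid M] {N : ℕ} {ζ : R} (hζ : IsPrimitiveRoot ζ (N + 1)) (f : R → M) :
    ∑ z ∈ nthRootsFinset (N + 1) (1 : R), f z = f 1 + ∑ j : Fin N, f (ζ ^ ((j : ℕ) + 1)) := by
  have h : ∑ j ∈ Finset.range (N + 1), f (ζ ^ j) = ∑ z ∈ nthRootsFinset (N + 1) (1 : R), f z := by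
    refine Finset.sum_bij (fun j _ => ζ ^ j) ?_ ?_ ?_ (fun _ _ => rfl)
    · intro j _
      rw [Polynomial.mem_nthRootsFinset N.succ_pos, ← pow_mul, mul_comm, pow_mul, hζ.pow_eq_one,
        one_pow]
    · intro i hi j hj hij
      exact hζ.pow_inj (Finset.mem_range.1 hi) (Finset.mem_range.1 hj) hij
    · intro z hz
      obtain ⟨i, hi, rfl⟩ :=
        hζ.eq_pow_of_pow_eq_one ((Polynomial.mem_nthRootsFinset N.succ_pos _).1 hz)
      exact ⟨i, Finset.mem_range.2 hi, rfl⟩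
  rw [← h, Finset.sum_range_succ', add_comm, pow_zero, Finset.sum_range]

/-- Multiplication by an `n`-th root of unity permutes the `n`-th roots of unity. -/
lemma sum_nthRootsFinset_mul_left {K M : Type*} [Field K] [AddCommMonoid M] {n : ℕ} (hn : 0 < n)
    {w : K} (hw : w ^ n = 1) (f : K → M) :
    ∑ z ∈ nthRootsFinset n (1 : K), f (w * z) = ∑ z ∈ nthRootsFinset n (1 : K), f z := by
  have hw0 : w ≠ 0 := by
    rintro rfl
    simp [hn.ne'] at hw
  refine Finset.sum_bij' (fun z _ => w * z) (fun z _ => w⁻¹ * z) ?_ ?_ ?_ ?_ (fun _ _ => rfl)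
  · intro z hz
    rw [Polynomial.mem_nthRootsFinset hn] at hz ⊢
    rw [mul_pow, hw, hz, one_mul]
  · intro z hz
    rw [Polynomial.mem_nthRootsFinset hn] at hz ⊢
    rw [mul_pow, inv_pow, hw, hz, inv_one, one_mul]
  · intro z _
    simp [hw0]
  · intro z _
    simp [hw0]

/-- Nontrivial power sums of the `n`-th roots of unity vanish. -/
lemma IsPrimitiveRoot.sum_nthRootsFinset_pow {K : Type*} [Field K] {n m : ℕ} {ζ : K}
    (hζ : IsPrimitiveRoot ζ n) (hm : 0 < m) (hmn : m < n) :
    ∑ z ∈ nthRootsFinset n (1 : K), z ^ m = 0 := by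
  have h := sum_nthRootsFinset_mul_left (hm.trans hmn) hζ.pow_eq_one (fun z => z ^ m)
  simp only [mul_pow, ← Finset.mul_sum] at h
  have h1 : ζ ^ m ≠ 1 := hζ.pow_ne_one_of_pos_of_lt hm.ne' hmn
  by_contra h0
  exact h1 (mul_right_cancel₀ h0 (h.trans (one_mul _).symm))

/-- The discrete Fourier transform of `z ↦ (1 + z) / (1 - z)` at `0`; the term at `z = 1` is `0`. -/
lemma sum_nthRootsFinset_cayley {n : ℕ} (hn : 0 < n) :
    ∑ z ∈ nthRootsFinset n (1 : ℂ), (1 + z) / (1 - z) = 0 := by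
  have h : ∑ z ∈ nthRootsFinset n (1 : ℂ), (1 + z) / (1 - z)
      = ∑ z ∈ nthRootsFinset n (1 : ℂ), -((1 + z) / (1 - z)) := by
    have hmem : ∀ z ∈ nthRootsFinset n (1 : ℂ), z⁻¹ ∈ nthRootsFinset n (1 : ℂ) := by
      intro z hz
      rw [Polynomial.mem_nthRootsFinset hn] at hz ⊢
      rw [inv_pow, hz, inv_one]
    refine Finset.sum_bij' (fun z _ => z⁻¹) (fun z _ => z⁻¹) hmem hmem
      (fun z _ => inv_inv z) (fun z _ => inv_inv z) ?_
    intro z hz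
    rw [Polynomial.mem_nthRootsFinset hn] at hz
    have hz0 : z ≠ 0 := by
      rintro rfl
      simp [hn.ne'] at hz
    rcases eq_or_ne z 1 with rfl | h1
    · simp
    · have h2 : 1 - z ≠ 0 := sub_ne_zero.2 h1.symm
      have h3 : z - 1 ≠ 0 := sub_ne_zero.2 h1
      have h4 : 1 - z⁻¹ ≠ 0 := by
        rw [sub_ne_zero]
        intro h
        exact h1 (inv_eq_one.1 h.symm)
      rw [← neg_div, div_eq_div_iff h2 h4]
      field_simp
      ring
  rw [Finset.sum_neg_distrib] at h
  exact self_eq_neg.1 h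

/-- The discrete Fourier transform of `z ↦ (1 + z) / (1 - z)`. -/
lemma IsPrimitiveRoot.sum_nthRootsFinset_cayley_mul_pow {n m : ℕ} {ζ : ℂ}
    (hζ : IsPrimitiveRoot ζ n) (hmn : m + 1 < n) :
    ∑ z ∈ nthRootsFinset n (1 : ℂ), (1 + z) / (1 - z) * z ^ (m + 1) = 2 * (m + 1) - n := by
  have hn : 0 < n := by omega
  have h1 : (1 : ℂ) ∈ nthRootsFinset n (1 : ℂ) := by simp [Polynomial.mem_nthRootsFinset hn]
  have step : ∀ m : ℕ, ∑ z ∈ nthRootsFinset n (1 : ℂ), (1 + z) / (1 - z) * z ^ (m + 1)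
      = ∑ z ∈ nthRootsFinset n (1 : ℂ), (1 + z) / (1 - z) * z ^ m + 2
        - (∑ z ∈ nthRootsFinset n (1 : ℂ), z ^ m
          + ∑ z ∈ nthRootsFinset n (1 : ℂ), z ^ (m + 1)) := by
    intro m
    have h2 : ∑ z ∈ nthRootsFinset n (1 : ℂ), (if z = 1 then (2 : ℂ) else 0) = 2 := by
      simp [h1]
    conv_rhs =>
      enter [1, 2]
      rw [← h2]
    rw [← Finset.sum_add_distrib, ← Finset.sum_add_distrib, ← Finset.sum_sub_distrib]
    refine Finset.sum_congr rfl fun z _ => ?_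
    split_ifs with hz
    · subst hz
      norm_num
    · have : 1 - z ≠ 0 := sub_ne_zero.2 (Ne.symm hz)
      field_simp
      ring
  induction m with
  | zero =>
    rw [step, hζ.sum_nthRootsFinset_pow (Nat.succ_pos 0) hmn]
    simp only [pow_zero, mul_one, sum_nthRootsFinset_cayley hn, Finset.sum_const,
      hζ.card_nthRootsFinset, nsmul_eq_mul]
    push_cast
    ring
  | succ m ih =>
    rw [step, ih (by omega), hζ.sum_nthRootsFinset_pow (Nat.succ_pos _) hmn,
      hζ.sum_nthRootsFinset_pow (Nat.succ_pos m) (by omega)]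
    push_cast
    ring

/-- The circulant matrix of `z ↦ (1 + z) / (1 - z)` on the powers of a primitive root of unity,
with one row and one column deleted. -/
lemma IsPrimitiveRoot.det_cayley {N : ℕ} {ζ : ℂ} (hζ : IsPrimitiveRoot ζ (N + 1)) :
    (Matrix.of fun k j : Fin N =>
      (1 + ζ ^ ((j : ℤ) - (k : ℤ))) / (1 - ζ ^ ((j : ℤ) - (k : ℤ)))).det * ((N + 1 : ℕ) : ℂ)
      = ∏ m : Fin N, (2 * ((m : ℂ) + 1) - ((N + 1 : ℕ) : ℂ)) := by
  set A : Matrix (Fin N) (Fin N) ℂ := Matrix.of fun k j : Fin N =>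
      (1 + ζ ^ ((j : ℤ) - (k : ℤ))) / (1 - ζ ^ ((j : ℤ) - (k : ℤ))) with hA
  have hζ0 : ζ ≠ 0 := hζ.ne_zero N.succ_ne_zero
  let V : Matrix (Fin N) (Fin N) ℂ := Matrix.of fun j m => (ζ ^ ((j : ℕ) + 1)) ^ ((m : ℕ) + 1)
  let W : Matrix (Fin N) (Fin N) ℂ := Matrix.of fun j m => V j m - 1
  have hroot : ∀ i : ℕ, (ζ ^ i) ^ (N + 1) = 1 := fun i => by
    rw [← pow_mul, mul_comm, pow_mul, hζ.pow_eq_one, one_pow]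
  have hAW : A * W = V * diagonal fun m : Fin N => 2 * ((m : ℂ) + 1) - ((N + 1 : ℕ) : ℂ) := by
    ext k m
    rw [mul_apply, mul_diagonal, ← hζ.sum_nthRootsFinset_cayley_mul_pow (by omega : (m : ℕ) + 1 < _)]
    set w := ζ ^ ((k : ℕ) + 1) with hw
    have hw0 : w ≠ 0 := pow_ne_zero _ hζ0
    let f : ℂ → ℂ := fun z => (1 + z / w) / (1 - z / w) * (z ^ ((m : ℕ) + 1) - 1)
    have hf := sum_nthRootsFinset_mul_left N.succ_pos (hroot (k + 1)) f
    rw [← hw, hζ.sum_nthRootsFinset_succ f] at hf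
    have hf1 : f 1 = 0 := by simp [f]
    rw [hf1, zero_add] at hf
    have hterm : ∀ j : Fin N, A k j * W j m = f (ζ ^ ((j : ℕ) + 1)) := by
      intro j
      have : ζ ^ ((j : ℤ) - (k : ℤ)) = ζ ^ ((j : ℕ) + 1) / w := by
        rw [hw, ← zpow_natCast, ← zpow_natCast, ← zpow_sub₀ hζ0]
        congr 1
        push_cast
        ring
      simp only [hA, W, V, f, Matrix.of_apply, this]
    rw [Finset.sum_congr rfl fun j _ => hterm j, ← hf]
    have hsplit : ∀ z, f (w * z) = w ^ ((m : ℕ) + 1) * ((1 + z) / (1 - z) * z ^ ((m : ℕ) + 1))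
        - (1 + z) / (1 - z) := by
      intro z
      simp only [f, mul_div_cancel_left₀ z hw0, mul_pow]
      ring
    simp only [hsplit, Finset.sum_sub_distrib, ← Finset.mul_sum]
    rw [sum_nthRootsFinset_cayley N.succ_pos, sub_zero]
    rfl
  have hVW : W = V * (1 + replicateCol Unit (fun _ : Fin N => (1 : ℂ)) *
      replicateRow Unit (fun _ : Fin N => (1 : ℂ))) := by
    ext j m
    have hrow : ∑ i : Fin N, V j i = -1 := by
      have h := hζ.sum_nthRootsFinset_succ fun z => z ^ ((j : ℕ) + 1)
      rw [hζ.sum_nthRootsFinset_pow (Nat.succ_pos _) (by omega), one_pow] at h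
      rw [eq_neg_iff_add_eq_zero, add_comm, h]
      congr 1
      refine Finset.sum_congr rfl fun i _ => ?_
      simp only [V, Matrix.of_apply, ← pow_mul]
      rw [mul_comm]
    rw [mul_add, mul_one, Matrix.add_apply, mul_apply]
    simp only [mul_apply, replicateCol_apply, replicateRow_apply, mul_one, Finset.univ_unique,
      Finset.sum_singleton, hrow]
    rfl
  have hV : V.det ≠ 0 := by
    have h : V = diagonal (fun j : Fin N => ζ ^ ((j : ℕ) + 1)) *
        vandermonde fun j : Fin N => ζ ^ ((j : ℕ) + 1) := by
      ext j m
      rw [diagonal_mul, vandermonde_apply, ← pow_succ']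
      rfl
    rw [h, det_mul, det_diagonal]
    refine mul_ne_zero (Finset.prod_ne_zero_iff.2 fun j _ => pow_ne_zero _ hζ0)
      (det_vandermonde_ne_zero_iff.2 fun i j hij => ?_)
    have := hζ.pow_inj (by omega) (by omega) hij
    omega
  have hW : W.det = V.det * ((N + 1 : ℕ) : ℂ) := by
    rw [hVW, det_mul, det_one_add_replicateCol_mul_replicateRow]
    simp [dotProduct, add_comm]
  have hdet := congrArg Matrix.det hAW
  rw [det_mul, det_mul, hW, det_diagonal] at hdet
  refine mul_left_cancel₀ hV ?_
  rw [← hdet]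
  ring

lemma prod_two_mul_add_one_sub_eq_doubleFactorial (K : ℕ) :
    ∏ m ∈ Finset.range (2 * K), (2 * ((m : ℂ) + 1) - ((2 * K + 1 : ℕ) : ℂ))
      = (-1) ^ K * ((2 * K - 1)‼ : ℂ) ^ 2 := by
  induction K with
  | zero => simp
  | succ K ih =>
    have hfac : (2 * (K + 1) - 1)‼ = (2 * K + 1) * (2 * K - 1)‼ := by
      cases K with
      | zero => rfl
      | succ K => exact Nat.doubleFactorial_add_two (2 * K + 1)
    have hshift : ∀ m : ℕ, 2 * (((m + 1 : ℕ) : ℂ) + 1) - ((2 * (K + 1) + 1 : ℕ) : ℂ)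
        = 2 * ((m : ℂ) + 1) - ((2 * K + 1 : ℕ) : ℂ) := by
      intro m
      push_cast
      ring
    rw [show 2 * (K + 1) = 2 * K + 1 + 1 by ring, Finset.prod_range_succ, Finset.prod_range_succ']
    rw [show 2 * K + 1 + 1 = 2 * (K + 1) by ring, Finset.prod_congr rfl fun m _ => hshift m, ih,
      hfac]
    push_cast
    ring

theorem stmt_1 (n : ℕ) (hn : 1 < n) (hodd : Odd n) (ζ : ℂ)
    (hζ : IsPrimitiveRoot ζ n) :
    ∑ τ ∈ Finset.univ.filter (fun τ : Equiv.Perm (Fin (n - 1)) => ∀ j, τ j ≠ j),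
      ((Equiv.Perm.sign τ : ℤ) : ℂ) *
        ∏ j : Fin (n - 1),
          (1 + ζ ^ ((j : ℤ) - (τ j : ℤ))) / (1 - ζ ^ ((j : ℤ) - (τ j : ℤ))) =
    (-1) ^ ((n - 1) / 2) * ((n - 2)‼ : ℂ) ^ 2 / n := by
  obtain ⟨K, rfl⟩ := hodd
  rw [show (2 * K + 1 - 1) / 2 = K by omega, show 2 * K + 1 - 2 = 2 * K - 1 by omega,
    ← prod_two_mul_add_one_sub_eq_doubleFactorial,
    Finset.prod_range fun m : ℕ => 2 * ((m : ℂ) + 1) - ((2 * K + 1 : ℕ) : ℂ), ← hζ.det_cayley,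
    mul_div_cancel_right₀ _ (Nat.cast_ne_zero.2 (2 * K).succ_ne_zero), det_apply']
  refine Finset.sum_subset (Finset.filter_subset _ _) fun τ _ hτ => ?_
  simp only [Finset.mem_filter, Finset.mem_univ, true_and, not_forall, not_not] at hτ
  obtain ⟨j, hj⟩ := hτ
  rw [Finset.prod_eq_zero (Finset.mem_univ j), mul_zero]
  simp [hj]
end

section
/- Let n > 1 be an odd integer, and let ζ ∈ ℂ be a primitive n-th root of unity. For j, k = 1, ..., n-1 define b_{jk} = (1 + ζ^{j-k})/(1 - ζ^{j-k}) if j ≠ k, and b_{jj} = 1. Then for every complex number x, det[x + b_{jk}]_{1 ≤ j,k ≤ n-1} = (-1)^{(n+1)/2} (nx + 1) ((n-1)!!)^2 / (n(n-1)). -/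
open scoped Nat

/-- The adjugate commutes with conjugation. -/
theorem Matrix.adjugate_conj_of_mul_eq_one {ι R : Type*} [Fintype ι] [DecidableEq ι] [CommRing R]
    {F G : Matrix ι ι R} (h : F * G = 1) (D : Matrix ι ι R) :
    (F * D * G).adjugate = F * D.adjugate * G := by
  have h' : G * F = 1 := mul_eq_one_comm.mp h
  have hF : F.adjugate = F.det • G := by
    rw [← mul_one F.adjugate, ← h, ← Matrix.mul_assoc, Matrix.adjugate_mul, Matrix.smul_mul,
      Matrix.one_mul]
  have hG : G.adjugate = G.det • F := by
    rw [← mul_one G.adjugate, ← h', ← Matrix.mul_assoc, Matrix.adjugate_mul, Matrix.smul_mul,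
      Matrix.one_mul]
  have hdet : F.det * G.det = 1 := by rw [← Matrix.det_mul, h, Matrix.det_one]
  rw [Matrix.adjugate_mul_distrib, Matrix.adjugate_mul_distrib, hF, hG]
  simp [smul_smul, hdet, Matrix.mul_assoc]

/-- The weighted geometric sum at a nontrivial `n`-th root of unity. -/
theorem sum_range_natCast_mul_pow_of_pow_eq_one {K : Type*} [Field K] {n : ℕ} {z : K}
    (hz : z ≠ 1) (hzn : z ^ n = 1) :
    ∑ r ∈ Finset.range n, (r : K) * z ^ r = -n / (1 - z) := by
  have hz' : 1 - z ≠ 0 := sub_ne_zero.mpr hz.symm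
  have key (m : ℕ) : (∑ r ∈ Finset.range m, (r : K) * z ^ r) * (1 - z) =
      (∑ r ∈ Finset.range m, z ^ r) * z - m * z ^ m := by
    induction m with
    | zero => simp
    | succ m ih =>
      rw [Finset.sum_range_succ, add_mul, ih, Finset.sum_range_succ]
      push_cast
      ring
  rw [eq_div_iff hz', key, geom_sum_eq hz, hzn]
  simp

/-- The discrete Fourier expansion of the circulant kernel of the determinant. -/
theorem sum_range_eigenvalue_mul_pow {n : ℕ} (hn : 0 < n) {z : ℂ} (hzn : z ^ n = 1) (x : ℂ) :
    ∑ r ∈ Finset.range n, (if r = 0 then n * x + 1 else n + 1 - 2 * r) * z ^ r =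
      n * (x + if z = 1 then 1 else (1 + z) / (1 - z)) := by
  have hsplit : ∑ r ∈ Finset.range n, (if r = 0 then n * x + 1 else n + 1 - 2 * r) * z ^ r =
      n * x - n + (n + 1) * ∑ r ∈ Finset.range n, z ^ r
        - 2 * ∑ r ∈ Finset.range n, (r : ℂ) * z ^ r := by
    obtain ⟨m, rfl⟩ := Nat.exists_eq_succ_of_ne_zero hn.ne'
    simp only [Finset.sum_range_succ', Finset.mul_sum, mul_add, Nat.succ_ne_zero, if_false]
    simp only [sub_mul, mul_assoc, Finset.sum_sub_distrib]
    simp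
    ring
  rw [hsplit]
  split_ifs with hz
  · subst hz
    have := congrArg (Nat.cast : ℕ → ℂ) (Finset.sum_range_id_mul_two n)
    push_cast [Nat.cast_sub (show 1 ≤ n from hn)] at this
    simp only [one_pow, mul_one, Finset.sum_const, Finset.card_range, nsmul_eq_mul]
    linear_combination -this
  · have hz' : 1 - z ≠ 0 := sub_ne_zero.mpr (Ne.symm hz)
    rw [sum_range_natCast_mul_pow_of_pow_eq_one hz hzn, geom_sum_eq hz, hzn]
    field_simp
    ring

/-- The product of the nonzero eigenvalues. -/
theorem prod_range_erase_eigenvalue (p : ℕ) (a : ℂ) :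
    ∏ r ∈ (Finset.range (2 * p + 3)).erase (p + 2),
      (if r = 0 then a else 2 * p + 4 - 2 * (r : ℂ)) =
      a * (2 ^ (p + 1) * (p + 1)!) * ((-2) ^ p * p !) := by
  have h1 : ∏ r ∈ Finset.range (p + 2), (if r = 0 then a else 2 * p + 4 - 2 * (r : ℂ)) =
      a * (2 ^ (p + 1) * (p + 1)!) := by
    rw [Finset.prod_range_succ', ← Finset.prod_range_reflect, ← Finset.prod_range_add_one_eq_factorial]
    have : ∀ j ∈ Finset.range (p + 1), (if p + 1 - 1 - j + 1 = 0 then a else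
        2 * p + 4 - 2 * ((p + 1 - 1 - j + 1 : ℕ) : ℂ)) = 2 * (j + 1 : ℕ) := by
      intro j hj
      have hj' : j ≤ p := by simpa [Nat.lt_succ_iff] using hj
      rw [if_neg (by omega), Nat.add_sub_cancel]
      push_cast [Nat.cast_sub hj']
      ring
    rw [Finset.prod_congr rfl this, Finset.prod_mul_distrib]
    push_cast
    simp
    ring
  have h2 : ∏ r ∈ Finset.range p, (2 * p + 4 - 2 * ((p + 3 + r : ℕ) : ℂ)) =
      (-2) ^ p * p ! := by
    rw [← Finset.prod_range_add_one_eq_factorial]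
    have : ∀ j ∈ Finset.range p, (2 * p + 4 - 2 * ((p + 3 + j : ℕ) : ℂ)) =
        (-2) * (j + 1 : ℕ) := by
      intro j _
      push_cast
      ring
    rw [Finset.prod_congr rfl this, Finset.prod_mul_distrib]
    push_cast
    simp
  have hset : (Finset.range (2 * p + 3)).erase (p + 2) =
      Finset.range (p + 2) ∪ (Finset.range p).map (addLeftEmbedding (p + 3)) := by
    ext r
    simp only [Finset.mem_erase, Finset.mem_range, Finset.mem_union, Finset.mem_map,
      addLeftEmbedding_apply]
    constructor
    · intro h
      by_cases hr : r < p + 2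
      · exact Or.inl hr
      · exact Or.inr ⟨r - (p + 3), by omega, by omega⟩
    · rintro (h | ⟨j, hj, rfl⟩) <;> omega
  rw [hset, Finset.prod_union, h1, Finset.prod_map, ← h2]
  · congr 1
    refine Finset.prod_congr rfl fun j _ => ?_
    rw [addLeftEmbedding_apply, if_neg (by omega)]
  · rw [Finset.disjoint_left]
    simp only [Finset.mem_range, Finset.mem_map, addLeftEmbedding_apply]
    rintro r hr ⟨j, _, rfl⟩
    omega

theorem stmt_3 (n : ℕ) (hn : 1 < n) (hodd : Odd n) (ζ : ℂ)
    (hζ : IsPrimitiveRoot ζ n) (x : ℂ) :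
    Matrix.det (Matrix.of fun j k : Fin (n - 1) =>
      x + if j = k then 1 else
        (1 + ζ ^ ((j : ℤ) - (k : ℤ))) / (1 - ζ ^ ((j : ℤ) - (k : ℤ)))) =
    (-1) ^ ((n + 1) / 2) * (n * x + 1) * ((n - 1)‼ : ℂ) ^ 2 / (n * (n - 1)) := by
  obtain ⟨p, rfl⟩ : ∃ p, n = 2 * p + 2 + 1 := by
    obtain ⟨k, rfl⟩ := hodd
    exact ⟨k - 1, by omega⟩
  simp only [Nat.add_sub_cancel]
  set n : ℕ := 2 * p + 2 + 1 with hndef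
  have hn0 : (n : ℂ) ≠ 0 := Nat.cast_ne_zero.mpr (by omega)
  have hζ0 : ζ ≠ 0 := hζ.ne_zero (by omega)
  let d : ℕ → ℂ := fun r => if r = 0 then n * x + 1 else n + 1 - 2 * r
  let F : Matrix (Fin n) (Fin n) ℂ := Matrix.of fun j r => ζ ^ ((j : ℤ) * r)
  let G : Matrix (Fin n) (Fin n) ℂ := Matrix.of fun r k => (n : ℂ)⁻¹ * ζ ^ (-((k : ℤ) * r))
  have hpow (j k r : Fin n) : ζ ^ ((j : ℤ) * r) * ζ ^ (-((k : ℤ) * r)) =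
      (ζ ^ ((j : ℤ) - k)) ^ (r : ℕ) := by
    rw [← zpow_add₀ hζ0, ← zpow_natCast, ← zpow_mul]
    congr 1
    ring
  have hzn (j k : Fin n) : (ζ ^ ((j : ℤ) - k)) ^ n = 1 := by
    rw [← zpow_natCast, ← zpow_mul, mul_comm, zpow_mul, zpow_natCast, hζ.pow_eq_one, one_zpow]
  have hz1 (j k : Fin n) : ζ ^ ((j : ℤ) - k) = 1 ↔ j = k := by
    rw [hζ.zpow_eq_one_iff_dvd]
    constructor
    · intro h
      have := Int.eq_zero_of_abs_lt_dvd h (by rw [abs_lt]; omega)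
      exact Fin.ext (by omega)
    · rintro rfl
      simp
  have hFG : F * G = 1 := by
    ext j k
    have : (F * G) j k = (n : ℂ)⁻¹ * ∑ r ∈ Finset.range n, (ζ ^ ((j : ℤ) - k)) ^ r := by
      rw [Matrix.mul_apply, Finset.mul_sum, ← Fin.sum_univ_eq_sum_range
        (fun r => (n : ℂ)⁻¹ * (ζ ^ ((j : ℤ) - k)) ^ r)]
      refine Finset.sum_congr rfl fun r _ => ?_
      simp only [F, G, Matrix.of_apply, ← hpow]
      ring
    rw [this, Matrix.one_apply]
    split_ifs with h
    · rw [(hz1 j k).mpr h]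
      simp [hn0]
    · rw [geom_sum_eq (mt (hz1 j k).mp h), hzn]
      simp
  let M : Matrix (Fin n) (Fin n) ℂ := F * Matrix.diagonal (fun r : Fin n => d r) * G
  have hM (j k : Fin n) : M j k = x + if j = k then 1 else
      (1 + ζ ^ ((j : ℤ) - (k : ℤ))) / (1 - ζ ^ ((j : ℤ) - (k : ℤ))) := by
    have h := sum_range_eigenvalue_mul_pow (by omega) (hzn j k) x
    simp only [hz1] at h
    rw [← mul_right_inj' hn0, ← h, show M j k = _ from Matrix.mul_apply, Finset.mul_sum,
      ← Fin.sum_univ_eq_sum_range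
        (fun r => (if r = 0 then n * x + 1 else n + 1 - 2 * r) * (ζ ^ ((j : ℤ) - k)) ^ r)]
    refine Finset.sum_congr rfl fun r _ => ?_
    simp only [Matrix.mul_diagonal, F, G, d, Matrix.of_apply, ← hpow]
    field_simp
  have hdet : Matrix.det (Matrix.of fun j k : Fin (2 * p + 2) =>
      x + if j = k then 1 else
        (1 + ζ ^ ((j : ℤ) - (k : ℤ))) / (1 - ζ ^ ((j : ℤ) - (k : ℤ)))) =
      M.adjugate (Fin.last _) (Fin.last _) := by
    rw [Matrix.adjugate_fin_succ_eq_det_submatrix, ← two_mul, pow_mul]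
    simp only [neg_one_sq, one_pow, one_mul, Fin.succAbove_last]
    congr 1
    ext j k
    rw [Matrix.submatrix_apply, hM]
    simp
  have hadj : M.adjugate (Fin.last _) (Fin.last _) =
      (n : ℂ)⁻¹ * ∑ r : Fin n, ∏ s ∈ Finset.univ.erase r, d s := by
    rw [Matrix.adjugate_conj_of_mul_eq_one hFG, Matrix.adjugate_diagonal, Matrix.mul_apply,
      Finset.mul_sum]
    refine Finset.sum_congr rfl fun r _ => ?_
    have h := hpow (Fin.last _) (Fin.last _) r
    rw [sub_self, zpow_zero, one_pow] at h
    simp only [Matrix.mul_diagonal, F, G, Matrix.of_apply]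
    linear_combination ((n : ℂ)⁻¹ * ∏ s ∈ Finset.univ.erase r, d s) * h
  let c : Fin n := ⟨p + 2, by omega⟩
  have hc : d c = 0 := by
    simp only [d, c, hndef]
    rw [if_neg (by omega)]
    push_cast
    ring
  have hsum : ∑ r : Fin n, ∏ s ∈ Finset.univ.erase r, d s =
      (n * x + 1) * (2 ^ (p + 1) * (p + 1)!) * ((-2) ^ p * p !) := by
    rw [Finset.sum_eq_single c
      (fun r _ hr => Finset.prod_eq_zero (Finset.mem_erase.mpr ⟨hr.symm, Finset.mem_univ c⟩) hc)
      (by simp), ← prod_range_erase_eigenvalue]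
    have hmap : (Finset.range (2 * p + 3)).erase (p + 2) =
        (Finset.univ.erase c).map Fin.valEmbedding := by
      rw [Finset.map_erase, Fin.map_valEmbedding_univ, Nat.Iio_eq_range]
      rfl
    rw [hmap, Finset.prod_map]
    refine Finset.prod_congr rfl fun r _ => ?_
    simp only [d, Fin.valEmbedding_apply, hndef]
    push_cast
    congr 1
    ring
  have hp : (p : ℂ) + 1 ≠ 0 := Nat.cast_add_one_ne_zero p
  have hn1 : (n : ℂ) - 1 = 2 * (p + 1) := by
    rw [hndef]
    push_cast
    ring
  refine hdet.trans ?_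
  rw [hadj, hsum, hn1, show (n + 1) / 2 = p + 2 by omega,
    show 2 * p + 2 = 2 * (p + 1) by ring, Nat.doubleFactorial_two_mul, Nat.factorial_succ,
    neg_pow 2 p]
  push_cast
  field_simp
  ring
end

section
/- Let n be a positive integer, let s ∈ {0, 1, ..., n-1}, let F be a field, and let ζ ∈ F be a primitive n-th root of unity. Then for every x ∈ F with x^n ≠ 1, ∑_{r=1}^{n-1} ζ^{-rs}/(1 - x ζ^r) = (∑_{j=0}^{n-1} x^j - n x^s)/(x^n - 1). -/
/-- Orthogonality of the powers of a primitive root of unity. -/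
theorem IsPrimitiveRoot.sum_zpow_sub_mul {F : Type*} [Field F] {ζ : F} {n : ℕ}
    (hζ : IsPrimitiveRoot ζ n) {j s : ℕ} (hj : j < n) (hs : s < n) :
    ∑ r ∈ Finset.range n, ζ ^ (((j : ℤ) - s) * r) = if j = s then (n : F) else 0 := by
  split_ifs with h
  · simp [h]
  · have hne : ζ ^ ((j : ℤ) - s) ≠ 1 := by
      rw [Ne, hζ.zpow_eq_one_iff_dvd]
      intro hd
      have := Int.eq_zero_of_abs_lt_dvd hd (by rw [abs_lt]; omega)
      omega
    have hpow : (ζ ^ ((j : ℤ) - s)) ^ n = 1 := by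
      rw [← zpow_natCast, zpow_comm, zpow_natCast, hζ.pow_eq_one, one_zpow]
    have hgeom := geom_sum_mul (ζ ^ ((j : ℤ) - s)) n
    rw [hpow, sub_self] at hgeom
    simpa [zpow_mul] using (mul_eq_zero.mp hgeom).resolve_right (sub_ne_zero.mpr hne)

/-- If `w ^ n = 1`, then `1 / (1 - x * w)` is a truncated geometric series over `1 - x ^ n`. -/
theorem inv_one_sub_mul_eq_geom_sum_div {F : Type*} [Field F] {n : ℕ} {x w : F}
    (hw : w ^ n = 1) (hx : x ^ n ≠ 1) :
    (1 - x * w)⁻¹ = (∑ j ∈ Finset.range n, (x * w) ^ j) / (1 - x ^ n) := by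
  have hgeom := geom_sum_mul_neg (x * w) n
  rw [mul_pow, hw, mul_one] at hgeom
  have hxn : 1 - x ^ n ≠ 0 := sub_ne_zero.mpr hx.symm
  have hxw : 1 - x * w ≠ 0 := right_ne_zero_of_mul (hgeom ▸ hxn)
  rw [eq_div_iff hxn, ← hgeom]
  field_simp

/-- The sum over all `n`-th roots of unity, including `1`. -/
theorem IsPrimitiveRoot.sum_range_zpow_div_one_sub_mul {F : Type*} [Field F] {ζ : F} {n : ℕ}
    (hζ : IsPrimitiveRoot ζ n) {s : ℕ} (hs : s < n) {x : F} (hx : x ^ n ≠ 1) :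
    ∑ r ∈ Finset.range n, ζ ^ (-(r * s : ℤ)) / (1 - x * ζ ^ r) =
      n * x ^ s / (1 - x ^ n) := by
  have hζ0 : ζ ≠ 0 := hζ.ne_zero (by omega)
  have hterm (r : ℕ) : ζ ^ (-(r * s : ℤ)) / (1 - x * ζ ^ r) =
      (∑ j ∈ Finset.range n, x ^ j * ζ ^ (((j : ℤ) - s) * r)) / (1 - x ^ n) := by
    have hw : (ζ ^ r) ^ n = 1 := by rw [pow_right_comm, hζ.pow_eq_one, one_pow]
    rw [div_eq_mul_inv, inv_one_sub_mul_eq_geom_sum_div hw hx, ← mul_div_assoc, Finset.mul_sum]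
    congr 1
    refine Finset.sum_congr rfl fun j _ => ?_
    rw [show ((j : ℤ) - s) * r = -(r * s : ℤ) + ((r * j : ℕ) : ℤ) by push_cast; ring,
      zpow_add₀ hζ0, zpow_natCast, mul_pow, pow_mul]
    ring
  simp_rw [hterm]
  rw [← Finset.sum_div, Finset.sum_comm]
  congr 1
  calc ∑ j ∈ Finset.range n, ∑ r ∈ Finset.range n, x ^ j * ζ ^ (((j : ℤ) - s) * r)
      = ∑ j ∈ Finset.range n, x ^ j * if j = s then (n : F) else 0 :=
        Finset.sum_congr rfl fun j hj => by
          rw [← Finset.mul_sum, hζ.sum_zpow_sub_mul (Finset.mem_range.mp hj) hs]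
    _ = n * x ^ s := by simp [hs, mul_comm]

theorem stmt_4 (n : ℕ) (hn : 0 < n) (s : ℕ) (hs : s < n)
    (F : Type*) [Field F] (ζ : F) (hζ : IsPrimitiveRoot ζ n)
    (x : F) (hx : x ^ n ≠ 1) :
    ∑ r ∈ Finset.Ico 1 n, ζ ^ (-(r * s : ℤ)) / (1 - x * ζ ^ r) =
      ((∑ j ∈ Finset.range n, x ^ j) - n * x ^ s) / (x ^ n - 1) := by
  have hsum := hζ.sum_range_zpow_div_one_sub_mul hs hx
  have hone := inv_one_sub_mul_eq_geom_sum_div (one_pow n) hx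
  simp only [mul_one] at hone
  rw [Finset.range_eq_Ico, Finset.sum_eq_sum_Ico_succ_bot hn] at hsum
  simp only [Nat.cast_zero, zero_mul, neg_zero, zpow_zero, pow_zero, one_div, mul_one,
    zero_add] at hsum
  rw [eq_sub_of_add_eq' hsum, hone, ← sub_div, ← neg_sub (1 : F), div_neg, ← neg_div, neg_sub]
end

section
/- Let n be an odd positive integer, let s ∈ {0, 1, ..., n-1}, and let ζ ∈ ℂ be a primitive n-th root of unity. Then ∑_{r=1}^{n-1} ζ^{-rs}/(1 + ζ^r) = ((-1)^s n - 1)/2. -/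
theorem one_add_pow_ne_zero_of_odd {n : ℕ} (hodd : Odd n) {ζ : ℂ} (hζ : ζ ^ n = 1) (r : ℕ) :
    1 + ζ ^ r ≠ 0 := by
  intro h
  have h1 : ζ ^ r = -1 := by linear_combination h
  have h2 : (ζ ^ r) ^ n = 1 := by rw [← pow_mul, mul_comm, pow_mul, hζ, one_pow]
  rw [h1, hodd.neg_one_pow] at h2
  norm_num at h2

theorem IsPrimitiveRoot.sum_Ico_zpow_neg_mul {n : ℕ} {ζ : ℂ} (hζ : IsPrimitiveRoot ζ n)
    {k : ℕ} (hk : k ≠ 0) (hkn : k < n) :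
    ∑ r ∈ Finset.Ico 1 n, ζ ^ (-(r * k : ℤ)) = -1 := by
  have hx : (ζ ^ k)⁻¹ ≠ 1 := by
    rw [ne_eq, inv_eq_one]
    exact hζ.pow_ne_one_of_pos_of_lt hk hkn
  have hxn : ((ζ ^ k)⁻¹) ^ n = 1 := by
    rw [inv_pow, ← pow_mul, mul_comm, pow_mul, hζ.pow_eq_one, one_pow, inv_one]
  have hterm (r : ℕ) : ζ ^ (-(r * k : ℤ)) = ((ζ ^ k)⁻¹) ^ r := by
    rw [zpow_neg, inv_pow, ← pow_mul, mul_comm k r]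
    norm_cast
  have hsum : ∑ r ∈ Finset.range n, ((ζ ^ k)⁻¹) ^ r = 0 := by
    rw [geom_sum_eq hx, hxn, sub_self, zero_div]
  rw [Finset.range_eq_Ico, Finset.sum_eq_sum_Ico_succ_bot (by omega), pow_zero] at hsum
  simp only [hterm]
  linear_combination hsum

theorem sum_Ico_one_div_one_add_pow {n : ℕ} (hodd : Odd n) {ζ : ℂ} (hζ : ζ ^ n = 1) :
    ∑ r ∈ Finset.Ico 1 n, 1 / (1 + ζ ^ r) = ((n : ℂ) - 1) / 2 := by
  have hreflect : ∑ r ∈ Finset.Ico 1 n, 1 / (1 + ζ ^ (n - r)) =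
      ∑ r ∈ Finset.Ico 1 n, 1 / (1 + ζ ^ r) := by
    have h := Finset.sum_Ico_reflect (fun r ↦ 1 / (1 + ζ ^ r)) 1 (Nat.le_succ n)
    simpa using h
  have hadd : ∑ r ∈ Finset.Ico 1 n, (1 / (1 + ζ ^ r) + 1 / (1 + ζ ^ (n - r))) = (n : ℂ) - 1 := by
    rw [Finset.sum_congr rfl (g := fun _ ↦ (1 : ℂ)), Finset.sum_const, Nat.card_Ico,
      nsmul_eq_mul, mul_one, Nat.cast_sub hodd.pos, Nat.cast_one]
    intro r hr
    have hmul : ζ ^ r * ζ ^ (n - r) = 1 := by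
      rw [← pow_add, Nat.add_sub_cancel' (Finset.mem_Ico.mp hr).2.le, hζ]
    have h1 := one_add_pow_ne_zero_of_odd hodd hζ r
    have h2 := one_add_pow_ne_zero_of_odd hodd hζ (n - r)
    rw [div_add_div _ _ h1 h2, div_eq_one_iff_eq (mul_ne_zero h1 h2)]
    linear_combination -hmul
  rw [Finset.sum_add_distrib, hreflect] at hadd
  linear_combination hadd / 2

theorem stmt_5 (n : ℕ) (hn : 0 < n) (hodd : Odd n) (s : ℕ) (hs : s < n)
    (ζ : ℂ) (hζ : IsPrimitiveRoot ζ n) :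
    ∑ r ∈ Finset.Ico 1 n, ζ ^ (-(r * s : ℤ)) / (1 + ζ ^ r) =
      ((-1) ^ s * (n : ℂ) - 1) / 2 := by
  induction s with
  | zero => simpa using sum_Ico_one_div_one_add_pow hodd hζ.pow_eq_one
  | succ s ih =>
    have hrec : ∑ r ∈ Finset.Ico 1 n, ζ ^ (-(r * (s + 1 : ℕ) : ℤ)) / (1 + ζ ^ r) +
        ∑ r ∈ Finset.Ico 1 n, ζ ^ (-(r * s : ℤ)) / (1 + ζ ^ r) = -1 := by
      rw [← hζ.sum_Ico_zpow_neg_mul s.succ_ne_zero hs, ← Finset.sum_add_distrib]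
      refine Finset.sum_congr rfl fun r _ ↦ ?_
      have hshift : ζ ^ (-(r * s : ℤ)) = ζ ^ (-(r * (s + 1 : ℕ) : ℤ)) * ζ ^ r := by
        rw [← zpow_natCast ζ r, ← zpow_add₀ (hζ.ne_zero hn.ne')]
        congr 1
        push_cast
        ring
      rw [← add_div, div_eq_iff (one_add_pow_ne_zero_of_odd hodd hζ.pow_eq_one r), hshift]
      ring
    rw [ih (by omega)] at hrec
    rw [pow_succ]
    linear_combination hrec
end

section
/- Let n be a positive integer, let s ∈ {0, 1, ..., n-1}, and let ζ ∈ ℂ be a primitive n-th root of unity. Then ∑_{r=1}^{n-1} ζ^{-rs}/(1 - ζ^r) = (n-1)/2 - s. -/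
theorem sum_Ico_pow_eq_neg_one {K : Type*} [Field K] {n : ℕ} (hn : 0 < n) {y : K}
    (hy : y ≠ 1) (hyn : y ^ n = 1) : ∑ r ∈ Finset.Ico 1 n, y ^ r = -1 := by
  have h := geom_sum_eq hy n
  rw [hyn, sub_self, zero_div, Finset.range_eq_Ico, Finset.sum_eq_sum_Ico_succ_bot hn,
    pow_zero] at h
  linear_combination h

theorem IsPrimitiveRoot.one_sub_pow_ne_zero {K : Type*} [Field K] {n : ℕ} {ζ : K}
    (hζ : IsPrimitiveRoot ζ n) {r : ℕ} (hr : r ∈ Finset.Ico 1 n) : 1 - ζ ^ r ≠ 0 := by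
  rw [Finset.mem_Ico] at hr
  exact sub_ne_zero.2 (hζ.pow_ne_one_of_pos_of_lt (by omega) hr.2).symm

theorem IsPrimitiveRoot.two_mul_sum_inv_one_sub_pow {K : Type*} [Field K] {n : ℕ} (hn : 0 < n)
    {ζ : K} (hζ : IsPrimitiveRoot ζ n) :
    2 * ∑ r ∈ Finset.Ico 1 n, (1 - ζ ^ r)⁻¹ = (n : K) - 1 := by
  have hreflect : ∑ r ∈ Finset.Ico 1 n, (1 - ζ ^ r)⁻¹ =
      ∑ r ∈ Finset.Ico 1 n, (1 - ζ ^ (n - r))⁻¹ := by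
    refine Finset.sum_nbij' (fun r => n - r) (fun r => n - r) ?_ ?_ ?_ ?_ ?_ <;>
      intro r hr <;> rw [Finset.mem_Ico] at hr
    · rw [Finset.mem_Ico]; omega
    · rw [Finset.mem_Ico]; omega
    · omega
    · omega
    · rw [Nat.sub_sub_self hr.2.le]
  have hpair : ∀ r ∈ Finset.Ico 1 n, (1 - ζ ^ r)⁻¹ + (1 - ζ ^ (n - r))⁻¹ = 1 := by
    intro r hr
    have h₁ := hζ.one_sub_pow_ne_zero hr
    rw [Finset.mem_Ico] at hr
    have h₂ := hζ.one_sub_pow_ne_zero (r := n - r) (by rw [Finset.mem_Ico]; omega)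
    have h₃ : ζ ^ r * ζ ^ (n - r) = 1 := by
      rw [← pow_add, Nat.add_sub_cancel' hr.2.le, hζ.pow_eq_one]
    field_simp
    linear_combination -h₃
  rw [two_mul]
  nth_rewrite 2 [hreflect]
  rw [← Finset.sum_add_distrib, Finset.sum_congr rfl hpair]
  simp [Nat.cast_sub (Nat.succ_le_of_lt hn)]

theorem stmt_6 (n : ℕ) (hn : 0 < n) (s : ℕ) (hs : s < n)
    (ζ : ℂ) (hζ : IsPrimitiveRoot ζ n) :
    ∑ r ∈ Finset.Ico 1 n, ζ ^ (-(r * s : ℤ)) / (1 - ζ ^ r) =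
      ((n : ℂ) - 1) / 2 - s := by
  induction s with
  | zero =>
    simp only [Nat.cast_zero, mul_zero, neg_zero, zpow_zero, one_div, sub_zero]
    linear_combination hζ.two_mul_sum_inv_one_sub_pow hn / 2
  | succ s ih =>
    have hζ0 : ζ ≠ 0 := hζ.ne_zero hn.ne'
    have hsum : ∑ r ∈ Finset.Ico 1 n, ((ζ ^ (s + 1))⁻¹) ^ r = -1 := by
      refine sum_Ico_pow_eq_neg_one hn ?_ ?_
      · rw [ne_eq, inv_eq_one]
        exact hζ.pow_ne_one_of_pos_of_lt s.succ_ne_zero hs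
      · rw [inv_pow, pow_right_comm, hζ.pow_eq_one, one_pow, inv_one]
    have hstep : ∀ r ∈ Finset.Ico 1 n, ζ ^ (-(r * (s + 1 : ℕ) : ℤ)) / (1 - ζ ^ r) =
        ζ ^ (-(r * s : ℤ)) / (1 - ζ ^ r) + ((ζ ^ (s + 1))⁻¹) ^ r := by
      intro r hr
      have h₁ := hζ.one_sub_pow_ne_zero hr
      have h₂ (m : ℕ) : ζ ^ (-(r * m : ℤ)) = (ζ ^ (r * m))⁻¹ := by
        rw [zpow_neg, ← Nat.cast_mul, zpow_natCast]
      rw [h₂, h₂, inv_pow, ← pow_mul, mul_comm (s + 1) r, mul_add_one, pow_add]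
      field_simp
      ring
    rw [Finset.sum_congr rfl hstep, Finset.sum_add_distrib, hsum, ih (by omega)]
    push_cast
    ring
end

section
/- Let n be a positive integer, let k ∈ {1, ..., n}, let s ∈ {0, 1, ..., n-1}, let F be a field, and let ζ ∈ F be a primitive n-th root of unity. Then for every x ∈ F with x^n ≠ 1, ∑_{j=1, j≠k}^{n} ((1 + x ζ^{j-k})/(1 - x ζ^{j-k})) ζ^{s(k-j)} = 1 + 2(∑_{j=0}^{n-1} x^j - n x^s)/(x^n - 1) - n δ_{s,0}, where δ_{s,0} equals 1 if s = 0 and 0 otherwise. -/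
theorem IsPrimitiveRoot.sum_Icc_zpow_sub_mul {F : Type*} [Field F] {ζ : F} {n : ℕ}
    (hn : 0 < n) (hζ : IsPrimitiveRoot ζ n) (k d : ℤ) :
    ∑ j ∈ Finset.Icc 1 n, ζ ^ (((j : ℤ) - k) * d) = if (n : ℤ) ∣ d then (n : F) else 0 := by
  have h0 : ζ ≠ 0 := hζ.ne_zero hn.ne'
  have hd : ζ ^ d = 1 ↔ (n : ℤ) ∣ d := hζ.zpow_eq_one_iff_dvd d
  have hterm (j : ℕ) : ζ ^ (((j : ℤ) - k) * d) = ζ ^ (-k * d) * (ζ ^ d) ^ j := by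
    rw [← zpow_natCast, ← zpow_mul, ← zpow_add₀ h0]
    ring_nf
  split_ifs with h
  · have h1 := hd.2 h
    have h2 : ζ ^ (-k * d) = 1 := by rw [mul_comm, zpow_mul, h1, one_zpow]
    simp only [hterm, h1, h2, one_pow, mul_one]
    simp
  · have h1 : ζ ^ d ≠ 1 := fun e => h (hd.1 e)
    have h2 : (ζ ^ d) ^ n = 1 := by
      rw [← zpow_natCast, zpow_comm, zpow_natCast, hζ.pow_eq_one, one_zpow]
    have h3 : ∑ i ∈ Finset.range n, (ζ ^ d) ^ i = 0 := by
      rw [geom_sum_eq h1, h2, sub_self, zero_div]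
    simp_rw [hterm]
    rw [← Finset.mul_sum, ← Finset.Ico_add_one_right_eq_Icc, Finset.sum_Ico_eq_sum_range]
    simp [pow_add, ← Finset.mul_sum, h3]

theorem one_add_div_one_sub_eq_geom_sum {F : Type*} [Field F] {y : F} {n : ℕ} (hy : y ^ n ≠ 1) :
    (1 + y) / (1 - y) = -1 + 2 / (1 - y ^ n) * ∑ t ∈ Finset.range n, y ^ t := by
  have h1 : 1 - y ≠ 0 := fun h => hy (by rw [← sub_eq_zero.1 h, one_pow])
  have h2 : 1 - y ^ n ≠ 0 := fun h => hy (sub_eq_zero.1 h).symm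
  have h3 := mul_neg_geom_sum y n
  field_simp
  linear_combination (-2) * h3

theorem stmt_7 (n : ℕ) (hn : 0 < n) (k : ℕ) (hk1 : 1 ≤ k) (hkn : k ≤ n)
    (s : ℕ) (hs : s < n) (F : Type*) [Field F] (ζ : F)
    (hζ : IsPrimitiveRoot ζ n) (x : F) (hx : x ^ n ≠ 1) :
    ∑ j ∈ (Finset.Icc 1 n).erase k,
        (1 + x * ζ ^ ((j : ℤ) - (k : ℤ))) / (1 - x * ζ ^ ((j : ℤ) - (k : ℤ))) *
          ζ ^ ((s : ℤ) * ((k : ℤ) - (j : ℤ))) =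
      1 + 2 * ((∑ j ∈ Finset.range n, x ^ j) - n * x ^ s) / (x ^ n - 1) -
        n * (if s = 0 then 1 else 0) := by
  have h0 : ζ ≠ 0 := hζ.ne_zero hn.ne'
  have hpow (j : ℕ) : (x * ζ ^ ((j : ℤ) - (k : ℤ))) ^ n = x ^ n := by
    rw [mul_pow, ← zpow_natCast (ζ ^ _), zpow_comm, zpow_natCast, hζ.pow_eq_one, one_zpow, mul_one]
  have hterm (j : ℕ) :
      (1 + x * ζ ^ ((j : ℤ) - (k : ℤ))) / (1 - x * ζ ^ ((j : ℤ) - (k : ℤ))) *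
          ζ ^ ((s : ℤ) * ((k : ℤ) - (j : ℤ))) =
        -ζ ^ (((j : ℤ) - k) * (-s : ℤ)) + 2 / (1 - x ^ n) *
          ∑ t ∈ Finset.range n, x ^ t * ζ ^ (((j : ℤ) - k) * ((t : ℤ) - s)) := by
    rw [one_add_div_one_sub_eq_geom_sum (by rwa [hpow]), hpow, add_mul, mul_assoc, Finset.sum_mul,
      show (s : ℤ) * ((k : ℤ) - j) = ((j : ℤ) - k) * (-s : ℤ) by ring, neg_one_mul]
    congr 2
    refine Finset.sum_congr rfl fun t _ => ?_
    rw [mul_pow, mul_assoc, ← zpow_natCast (ζ ^ _), ← zpow_mul, ← zpow_add₀ h0]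
    ring_nf
  have hdvd (t : ℕ) (ht : t ∈ Finset.range n) : (n : ℤ) ∣ (t : ℤ) - s ↔ t = s := by
    rw [Finset.mem_range] at ht
    refine ⟨fun h => ?_, fun h => by simp [h]⟩
    have := Int.eq_zero_of_abs_lt_dvd h (by rw [abs_lt]; omega)
    omega
  have hdvd0 : (n : ℤ) ∣ -(s : ℤ) ↔ s = 0 := by
    have := hdvd 0 (by simpa using hn)
    rw [Nat.cast_zero, zero_sub] at this
    rw [this, eq_comm]
  have hfull : ∑ j ∈ Finset.Icc 1 n,
      (1 + x * ζ ^ ((j : ℤ) - (k : ℤ))) / (1 - x * ζ ^ ((j : ℤ) - (k : ℤ))) *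
          ζ ^ ((s : ℤ) * ((k : ℤ) - (j : ℤ))) =
      -(n * (if s = 0 then 1 else 0)) + 2 / (1 - x ^ n) * (n * x ^ s) := by
    simp_rw [hterm]
    rw [Finset.sum_add_distrib, Finset.sum_neg_distrib, ← Finset.mul_sum, Finset.sum_comm,
      hζ.sum_Icc_zpow_sub_mul hn]
    simp_rw [← Finset.mul_sum, hζ.sum_Icc_zpow_sub_mul hn]
    rw [Finset.sum_congr rfl fun t ht => by rw [if_congr (hdvd t ht) rfl rfl]]
    simp [hdvd0, hs, mul_comm]
  have hk := Finset.add_sum_erase (Finset.Icc 1 n) (fun j : ℕ =>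
    (1 + x * ζ ^ ((j : ℤ) - (k : ℤ))) / (1 - x * ζ ^ ((j : ℤ) - (k : ℤ))) *
      ζ ^ ((s : ℤ) * ((k : ℤ) - (j : ℤ)))) (Finset.mem_Icc.2 ⟨hk1, hkn⟩)
  simp only [sub_self, mul_zero, zpow_zero, mul_one, hfull,
    one_add_div_one_sub_eq_geom_sum hx] at hk
  rw [← neg_sub 1 (x ^ n), div_neg]
  linear_combination hk
end

section
/- Let n be a positive integer, let k ∈ {1, ..., n}, let s ∈ {0, 1, ..., n-1}, and let ζ ∈ ℂ be a primitive n-th root of unity. Then ∑_{j=1, j≠k}^{n} ((1 + ζ^{j-k})/(1 - ζ^{j-k})) ζ^{s(k-j)} equals n - 2s if 0 < s < n, and equals 0 if s = 0. -/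
open Polynomial in
theorem IsPrimitiveRoot.sum_nthRootsFinset_inv_pow_eq_zero {K : Type*} [Field K] {ζ : K} {n s : ℕ}
    (hζ : IsPrimitiveRoot ζ n) (h0 : 0 < s) (hs : s < n) :
    ∑ w ∈ nthRootsFinset n (1 : K), w⁻¹ ^ s = 0 := by
  have hn : 0 < n := h0.trans hs
  have hζ0 : ζ ≠ 0 := hζ.ne_zero hn.ne'
  have h : ∑ w ∈ nthRootsFinset n (1 : K), w⁻¹ ^ s =
      ∑ w ∈ nthRootsFinset n (1 : K), (ζ * w)⁻¹ ^ s := by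
    symm
    refine Finset.sum_nbij' (ζ * ·) (ζ⁻¹ * ·) ?_ ?_ ?_ ?_ ?_ <;>
      simp +contextual [Polynomial.mem_nthRootsFinset hn, mul_pow, hζ.pow_eq_one, hζ0]
  simp only [mul_inv, mul_pow, ← Finset.mul_sum] at h
  refine (mul_eq_zero.mp (?_ : ((ζ⁻¹) ^ s - 1) * _ = 0)).resolve_left ?_
  · rw [sub_mul, one_mul, ← h, sub_self]
  · rw [sub_eq_zero]
    exact hζ.inv.pow_ne_one_of_pos_of_lt h0.ne' hs

open Polynomial in
theorem sum_nthRootsFinset_erase_one_div {K : Type*} [Field K] [CharZero K] [DecidableEq K]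
    {n : ℕ} (hn : 0 < n) :
    ∑ w ∈ (nthRootsFinset n (1 : K)).erase 1, (1 + w) / (1 - w) = 0 := by
  have h : ∑ w ∈ (nthRootsFinset n (1 : K)).erase 1, (1 + w) / (1 - w) =
      ∑ w ∈ (nthRootsFinset n (1 : K)).erase 1, -((1 + w) / (1 - w)) := by
    refine Finset.sum_nbij' (·⁻¹) (·⁻¹) ?_ ?_ ?_ ?_ ?_
    iterate 4 simp +contextual [Polynomial.mem_nthRootsFinset hn]
    intro w hw
    simp only [Finset.mem_erase, Polynomial.mem_nthRootsFinset hn] at hw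
    have hw0 : w ≠ 0 := by
      rintro rfl
      simp [hn.ne'] at hw
    have h1 : 1 - w ≠ 0 := sub_ne_zero.mpr hw.1.symm
    have h2 : w - 1 ≠ 0 := sub_ne_zero.mpr hw.1
    have h3 : 1 - w⁻¹ ≠ 0 := by
      rw [sub_ne_zero]
      exact fun h => hw.1 (inv_eq_one.mp h.symm)
    rw [← neg_div, div_eq_div_iff h1 h3]
    field_simp
    ring
  rw [Finset.sum_neg_distrib] at h
  exact self_eq_neg.mp h

open Polynomial in
theorem IsPrimitiveRoot.sum_nthRootsFinset_erase_one_div_mul_inv_pow {K : Type*} [Field K]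
    [CharZero K] [DecidableEq K] {ζ : K} {n : ℕ} (hζ : IsPrimitiveRoot ζ n) (s : ℕ) (hs : s < n) :
    ∑ w ∈ (nthRootsFinset n (1 : K)).erase 1, (1 + w) / (1 - w) * w⁻¹ ^ s =
      if s = 0 then 0 else (n : K) - 2 * s := by
  have hn : 0 < n := by lia
  have h1 : (1 : K) ∈ nthRootsFinset n (1 : K) := by simp [Polynomial.mem_nthRootsFinset hn]
  have sum_pow (t : ℕ) (h0 : 0 < t) (ht : t < n) :
      ∑ w ∈ (nthRootsFinset n (1 : K)).erase 1, w⁻¹ ^ t = -1 := by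
    rw [Finset.sum_erase_eq_sub h1, hζ.sum_nthRootsFinset_inv_pow_eq_zero h0 ht]
    simp
  induction s with
  | zero => simpa using sum_nthRootsFinset_erase_one_div hn
  | succ s ih =>
    have step : ∑ w ∈ (nthRootsFinset n (1 : K)).erase 1, (1 + w) / (1 - w) * w⁻¹ ^ (s + 1) =
        ∑ w ∈ (nthRootsFinset n (1 : K)).erase 1,
          ((1 + w) / (1 - w) * w⁻¹ ^ s + w⁻¹ ^ (s + 1) + w⁻¹ ^ s) := by
      refine Finset.sum_congr rfl fun w hw => ?_
      simp only [Finset.mem_erase, Polynomial.mem_nthRootsFinset hn] at hw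
      have hw0 : w ≠ 0 := by
        rintro rfl
        simp [hn.ne'] at hw
      have h1 : 1 - w ≠ 0 := sub_ne_zero.mpr hw.1.symm
      rw [pow_succ]
      generalize w⁻¹ ^ s = a
      field_simp
      ring
    rw [step, Finset.sum_add_distrib, Finset.sum_add_distrib, ih (by lia),
      sum_pow (s + 1) (by lia) hs]
    rcases Nat.eq_zero_or_pos s with rfl | h0
    · have : 1 ≤ n := hn
      simp [Finset.card_erase_of_mem h1, hζ.card_nthRootsFinset, Nat.cast_sub this]
      ring
    · rw [sum_pow s h0 (by lia)]
      simp [h0.ne']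
      ring

open Polynomial in
theorem IsPrimitiveRoot.image_zpow_sub_Icc {K : Type*} [Field K] [DecidableEq K] {ζ : K} {n : ℕ}
    (hζ : IsPrimitiveRoot ζ n) (hn : 0 < n) (k : ℕ) :
    Set.InjOn (fun j : ℕ => ζ ^ ((j : ℤ) - k)) (Finset.Icc 1 n) ∧
      (Finset.Icc 1 n).image (fun j : ℕ => ζ ^ ((j : ℤ) - k)) = nthRootsFinset n (1 : K) := by
  have hζ0 : ζ ≠ 0 := hζ.ne_zero hn.ne'
  have inj : Set.InjOn (fun j : ℕ => ζ ^ ((j : ℤ) - k)) (Finset.Icc 1 n) := by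
    intro i hi j hj hij
    simp only [Finset.coe_Icc, Set.mem_Icc] at hi hj
    have h : ζ ^ ((i : ℤ) - j) = 1 := by
      rw [← sub_sub_sub_cancel_right (i : ℤ) j k, zpow_sub₀ hζ0]
      exact (div_eq_one_iff_eq (zpow_ne_zero _ hζ0)).mpr hij
    have hd := (hζ.zpow_eq_one_iff_dvd _).mp h
    have := Int.eq_zero_of_abs_lt_dvd hd (by rw [abs_lt]; lia)
    lia
  refine ⟨inj, Finset.eq_of_subset_of_card_le ?_ ?_⟩
  · intro w hw
    obtain ⟨j, -, rfl⟩ := Finset.mem_image.mp hw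
    rw [Polynomial.mem_nthRootsFinset hn, ← zpow_natCast, zpow_comm, zpow_natCast, hζ.pow_eq_one, one_zpow]
  · rw [Finset.card_image_of_injOn inj, hζ.card_nthRootsFinset]
    simp

theorem stmt_8 (n : ℕ) (hn : 0 < n) (k : ℕ) (hk1 : 1 ≤ k) (hkn : k ≤ n)
    (s : ℕ) (hs : s < n) (ζ : ℂ) (hζ : IsPrimitiveRoot ζ n) :
    ∑ j ∈ (Finset.Icc 1 n).erase k,
        (1 + ζ ^ ((j : ℤ) - (k : ℤ))) / (1 - ζ ^ ((j : ℤ) - (k : ℤ))) *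
          ζ ^ ((s : ℤ) * ((k : ℤ) - (j : ℤ))) =
      if s = 0 then 0 else (n : ℂ) - 2 * s := by
  obtain ⟨inj, himage⟩ := hζ.image_zpow_sub_Icc hn k
  have hk : k ∈ Finset.Icc 1 n := Finset.mem_Icc.mpr ⟨hk1, hkn⟩
  rw [← hζ.sum_nthRootsFinset_erase_one_div_mul_inv_pow s hs, ← himage,
    Finset.sum_erase_eq_sub hk, Finset.sum_erase_eq_sub (Finset.mem_image.mpr ⟨k, hk, by simp⟩),
    Finset.sum_image inj]
  congr 1
  · refine Finset.sum_congr rfl fun j _ => ?_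
    rw [← zpow_neg, neg_sub, mul_comm (s : ℤ), zpow_mul, zpow_natCast]
  · simp
end

section
/- Let n ≥ 2 be an integer, and let ζ ∈ ℂ be a primitive n-th root of unity. For j, k = 1, ..., n define c_{jk} = 1/(1 - ζ^{j-k}) if j ≠ k, and c_{jj} = 0. Then the characteristic polynomial of the n × n matrix [c_{jk} + δ_{jk}]_{1 ≤ j,k ≤ n} satisfies det(x I_n - [c_{jk} + δ_{jk}]) = ∏_{s=1}^{n} (x - (s - (n-1)/2)); equivalently, the n eigenvalues of [c_{jk} + δ_{jk}]_{1 ≤ j,k ≤ n} are s - (n-1)/2 for s = 1, ..., n. -/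
/-- The powers of an `n`-th root of unity other than `1` sum to zero. -/
theorem sum_fin_pow_eq_zero {K : Type*} [Field K] {n : ℕ} {w : K} (hw : w ^ n = 1) (h1 : w ≠ 1) :
    ∑ k : Fin n, w ^ (k : ℕ) = 0 := by
  rw [Fin.sum_univ_eq_sum_range (fun k => w ^ k) n, geom_sum_eq h1, hw]
  simp

theorem IsPrimitiveRoot.zpow_sub_fin_ne_one {K : Type*} [Field K] {n : ℕ} {ζ : K}
    (hζ : IsPrimitiveRoot ζ n) {j k : Fin n} (h : j ≠ k) : ζ ^ ((j : ℤ) - (k : ℤ)) ≠ 1 := by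
  intro h1
  rw [hζ.zpow_eq_one_iff_dvd] at h1
  have hj := j.isLt
  have hk := k.isLt
  refine h (Fin.ext ?_)
  have := Int.eq_zero_of_abs_lt_dvd h1 (by rw [abs_lt]; omega)
  omega

theorem IsPrimitiveRoot.sum_zpow_sub_pow_eq_zero {K : Type*} [Field K] {n : ℕ} {ζ : K}
    (hζ : IsPrimitiveRoot ζ n) (j : Fin n) {r : ℕ} (hr : 0 < r) (hrn : r < n) :
    ∑ k : Fin n, (ζ ^ ((k : ℤ) - (j : ℤ))) ^ r = 0 := by
  have h0 : ζ ≠ 0 := hζ.ne_zero (by omega)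
  have key (k : Fin n) :
      (ζ ^ ((k : ℤ) - (j : ℤ))) ^ r = ((ζ ^ (j : ℕ)) ^ r)⁻¹ * (ζ ^ r) ^ (k : ℕ) := by
    rw [zpow_sub₀ h0, zpow_natCast, zpow_natCast, div_pow, pow_right_comm ζ r, div_eq_inv_mul]
  simp_rw [key]
  rw [← Finset.mul_sum, sum_fin_pow_eq_zero, mul_zero]
  · rw [pow_right_comm, hζ.pow_eq_one, one_pow]
  · exact hζ.pow_ne_one_of_pos_of_lt hr.ne' hrn

/-- The eigenvalues of the circulant matrix with off-diagonal entries `1 / (1 - ζ ^ (j - k))`. -/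
theorem IsPrimitiveRoot.sum_inv_one_sub_zpow_mul {K : Type*} [Field K] [CharZero K] {n : ℕ} {ζ : K}
    (hζ : IsPrimitiveRoot ζ n) (j : Fin n) {r : ℕ} (hr : r < n) :
    ∑ k : Fin n, (if j = k then (0 : K) else 1 / (1 - ζ ^ ((j : ℤ) - (k : ℤ)))) *
      (ζ ^ ((k : ℤ) - (j : ℤ))) ^ r = ((n : K) - 1) / 2 - r := by
  set c : Fin n → K := fun k => if j = k then (0 : K) else 1 / (1 - ζ ^ ((j : ℤ) - (k : ℤ)))
    with hc
  set u : Fin n → K := fun k => ζ ^ ((k : ℤ) - (j : ℤ)) with hu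
  change ∑ k, c k * u k ^ r = _
  have h0 : ζ ≠ 0 := hζ.ne_zero (by omega)
  have hterm (r : ℕ) (k : Fin n) :
      c k * u k ^ (r + 1) = c k * u k ^ r + (u k ^ (r + 1) - if j = k then 1 else 0) := by
    by_cases h : j = k
    · subst h
      simp [hc, hu]
    · have h1 : u k ≠ 1 := hζ.zpow_sub_fin_ne_one (Ne.symm h)
      have h2 : u k ≠ 0 := zpow_ne_zero _ h0
      have h3 : ζ ^ ((j : ℤ) - (k : ℤ)) = (u k)⁻¹ := by
        rw [hu, ← zpow_neg, neg_sub]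
      have h4 : 1 - (u k)⁻¹ ≠ 0 := by
        rw [sub_ne_zero]
        exact fun h => h1 (inv_eq_one.mp h.symm)
      have h5 : c k * (1 - (u k)⁻¹) = 1 := by
        simp only [hc, if_neg h, h3]
        exact one_div_mul_cancel h4
      have h6 : c k * (u k - 1) = u k := by
        calc c k * (u k - 1) = c k * (1 - (u k)⁻¹) * u k := by field_simp
          _ = u k := by rw [h5, one_mul]
      simp only [if_neg h, sub_zero]
      linear_combination u k ^ r * h6
  have hS (r : ℕ) (hr : r < n) : ∑ k, c k * u k ^ r = ∑ k, c k - r := by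
    induction r with
    | zero => simp
    | succ r ih =>
      simp_rw [hterm r]
      rw [Finset.sum_add_distrib, Finset.sum_sub_distrib, ih (by omega),
        hζ.sum_zpow_sub_pow_eq_zero j (Nat.succ_pos r) hr]
      simp
      ring
  have hzero : ∑ r : Fin n, ∑ k, c k * u k ^ (r : ℕ) = 0 := by
    rw [Finset.sum_comm]
    refine Finset.sum_eq_zero fun k _ => ?_
    rw [← Finset.mul_sum]
    by_cases h : j = k
    · simp [hc, h]
    · rw [sum_fin_pow_eq_zero _ (hζ.zpow_sub_fin_ne_one (Ne.symm h)), mul_zero]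
      rw [← zpow_natCast, zpow_comm, zpow_natCast, hζ.pow_eq_one, one_zpow]
  have hn : (n : K) ≠ 0 := Nat.cast_ne_zero.mpr (by omega)
  have hgauss : ∑ r : Fin n, ((r : ℕ) : K) = n * (n - 1) / 2 := by
    rw [Fin.sum_univ_eq_sum_range (fun r => (r : K)) n, eq_div_iff two_ne_zero, ← Nat.cast_sum]
    have := congrArg (Nat.cast (R := K)) (Finset.sum_range_id_mul_two n)
    rw [Nat.cast_mul, Nat.cast_mul, Nat.cast_sub (by omega)] at this
    exact_mod_cast this
  rw [Finset.sum_congr rfl fun (r : Fin n) _ => hS r r.isLt, Finset.sum_sub_distrib, hgauss] at hzero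
  simp only [Finset.sum_const, Finset.card_univ, Fintype.card_fin, nsmul_eq_mul] at hzero
  rw [hS r hr]
  have : ∑ k, c k = ((n : K) - 1) / 2 := by
    apply mul_left_cancel₀ hn
    linear_combination hzero
  rw [this]

theorem stmt_10 (n : ℕ) (hn : 2 ≤ n) (ζ : ℂ) (hζ : IsPrimitiveRoot ζ n)
    (x : ℂ) :
    Matrix.det (x • (1 : Matrix (Fin n) (Fin n) ℂ) -
      Matrix.of fun j k : Fin n =>
        (if j = k then (0 : ℂ) else 1 / (1 - ζ ^ ((j : ℤ) - (k : ℤ)))) +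
          (if j = k then 1 else 0)) =
    ∏ s ∈ Finset.Icc 1 n, (x - ((s : ℂ) - ((n : ℂ) - 1) / 2)) := by
  set A : Matrix (Fin n) (Fin n) ℂ := Matrix.of fun j k : Fin n =>
        (if j = k then (0 : ℂ) else 1 / (1 - ζ ^ ((j : ℤ) - (k : ℤ)))) +
          (if j = k then 1 else 0) with hA
  have h0 : ζ ≠ 0 := hζ.ne_zero (by omega)
  let V : Matrix (Fin n) (Fin n) ℂ := Matrix.vandermonde fun k => ζ ^ (k : ℕ)
  let d : Fin n → ℂ := fun r => ((n : ℂ) - 1) / 2 - (r : ℕ) + 1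
  have hV : V.det ≠ 0 := Matrix.det_vandermonde_ne_zero_iff.mpr fun j k h =>
    Fin.ext (hζ.pow_inj j.isLt k.isLt h)
  have hAV : A * V = V * Matrix.diagonal d := by
    ext j r
    rw [Matrix.mul_diagonal, Matrix.mul_apply]
    have key (k : Fin n) : V k r = V j r * (ζ ^ ((k : ℤ) - (j : ℤ))) ^ (r : ℕ) := by
      simp only [V, Matrix.vandermonde_apply]
      rw [← mul_pow, zpow_sub₀ h0, zpow_natCast, zpow_natCast, mul_div_cancel₀ _ (pow_ne_zero _ h0)]
    have hsum := hζ.sum_inv_one_sub_zpow_mul j r.isLt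
    calc ∑ k, A j k * V k r
        = ∑ k, (V j r * ((if j = k then (0 : ℂ) else 1 / (1 - ζ ^ ((j : ℤ) - (k : ℤ)))) *
            (ζ ^ ((k : ℤ) - (j : ℤ))) ^ (r : ℕ)) + if j = k then V k r else 0) := by
          refine Finset.sum_congr rfl fun k _ => ?_
          rw [hA, Matrix.of_apply, add_mul, boole_mul]
          nth_rewrite 1 [key k]
          ring
      _ = V j r * d r := by
          rw [Finset.sum_add_distrib, ← Finset.mul_sum, hsum, Finset.sum_ite_eq,
            if_pos (Finset.mem_univ j)]
          simp only [d]
          ring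
  have hconj : (x • (1 : Matrix (Fin n) (Fin n) ℂ) - A) * V =
      V * Matrix.diagonal fun r => x - d r := by
    rw [sub_mul, hAV, ← Matrix.diagonal_sub, mul_sub, ← Matrix.smul_one_eq_diagonal]
    simp
  have hdet : (x • (1 : Matrix (Fin n) (Fin n) ℂ) - A).det = ∏ r : Fin n, (x - d r) := by
    apply mul_right_cancel₀ hV
    rw [← Matrix.det_mul, hconj, Matrix.det_mul, Matrix.det_diagonal, mul_comm]
  rw [hdet, Fin.prod_univ_eq_prod_range (fun r => x - (((n : ℂ) - 1) / 2 - (r : ℕ) + 1)) n]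
  refine Finset.prod_nbij' (fun r => n - r) (fun s => n - s) ?_ ?_ ?_ ?_ ?_
  · simp only [Finset.mem_range, Finset.mem_Icc]; omega
  · simp only [Finset.mem_range, Finset.mem_Icc]; omega
  · simp only [Finset.mem_range]; omega
  · simp only [Finset.mem_Icc]; omega
  · intro r hr
    rw [Nat.cast_sub (Finset.mem_range.mp hr).le]
    ring
end

section
/- Let n ≥ 2 be an integer, and let ζ ∈ ℂ be a primitive n-th root of unity. For j, k = 1, ..., n define c_{jk} = 1/(1 - ζ^{j-k}) if j ≠ k, and c_{jj} = 0. Then det(x I_n - [2 c_{jk}]_{1 ≤ j,k ≤ n}) = ∏_{s=1}^{n} (x - (2s - n - 1)) as polynomials in x; that is, the n eigenvalues of the matrix [2 c_{jk}]_{1 ≤ j,k ≤ n} are 2s - n - 1 for s = 1, ..., n. -/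
lemma IsPrimitiveRoot.pow_fin_val_add {n : ℕ} {ζ : ℂ} (hζ : IsPrimitiveRoot ζ n) (a b : Fin n) :
    ζ ^ ((a + b : Fin n) : ℕ) = ζ ^ (a : ℕ) * ζ ^ (b : ℕ) := by
  rw [Fin.val_add, ← pow_add, ← pow_mod_orderOf ζ ((a : ℕ) + b), ← hζ.eq_orderOf]

lemma IsPrimitiveRoot.pow_fin_val_injective {n : ℕ} {ζ : ℂ} (hζ : IsPrimitiveRoot ζ n) :
    Function.Injective fun k : Fin n => ζ ^ (k : ℕ) :=
  fun a b h => Fin.ext (hζ.pow_inj a.2 b.2 h)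

/-- The sum of `1 / (1 - w)` over the nontrivial `n`-th roots of unity `w = ζ ^ (j - k)`. -/
lemma IsPrimitiveRoot.sum_div_pow_sub_pow {n : ℕ} {ζ : ℂ} (hζ : IsPrimitiveRoot ζ n)
    (j : Fin n) :
    2 * ∑ k : Fin n, (if j = k then (0 : ℂ) else ζ ^ (k : ℕ) / (ζ ^ (k : ℕ) - ζ ^ (j : ℕ))) =
      n - 1 := by
  have : NeZero n := ⟨by have := j.2; omega⟩
  have h0 : ζ ≠ 0 := hζ.ne_zero (NeZero.ne n)
  have hrefl : ∀ k : Fin n, ζ ^ ((j + j - k : Fin n) : ℕ) * ζ ^ (k : ℕ) =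
      ζ ^ (j : ℕ) * ζ ^ (j : ℕ) := fun k => by
    rw [← hζ.pow_fin_val_add, ← hζ.pow_fin_val_add, sub_add_cancel]
  have hsum : ∑ k : Fin n, (if j = k then (0 : ℂ) else 1) = n - 1 := by
    have h : ∀ k : Fin n, (if j = k then (0 : ℂ) else 1) = 1 - if j = k then 1 else 0 :=
      fun k => by split_ifs <;> simp
    simp [h]
  rw [← hsum, two_mul]
  nth_rewrite 2 [← (Equiv.subLeft (j + j)).sum_comp]
  rw [← Finset.sum_add_distrib]
  refine Finset.sum_congr rfl fun k _ => ?_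
  simp only [Equiv.subLeft_apply]
  have hiff : j = j + j - k ↔ j = k := by
    rw [eq_sub_iff_add_eq, add_right_inj, eq_comm]
  by_cases hjk : j = k
  · simp [hjk]
  · have hne : ζ ^ (k : ℕ) - ζ ^ (j : ℕ) ≠ 0 :=
      sub_ne_zero.2 fun h => hjk (hζ.pow_fin_val_injective h).symm
    have hk : ζ ^ (k : ℕ) ≠ 0 := pow_ne_zero _ h0
    have hj : ζ ^ (j : ℕ) ≠ 0 := pow_ne_zero _ h0
    have hne' : ζ ^ (j : ℕ) - ζ ^ (k : ℕ) ≠ 0 := by rwa [← neg_sub, neg_ne_zero]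
    rw [if_neg hjk, if_neg (hiff.not.2 hjk), if_neg hjk, eq_div_of_mul_eq hk (hrefl k)]
    have hd : ζ ^ (j : ℕ) * ζ ^ (j : ℕ) / ζ ^ (k : ℕ) - ζ ^ (j : ℕ) =
        ζ ^ (j : ℕ) * (ζ ^ (j : ℕ) - ζ ^ (k : ℕ)) / ζ ^ (k : ℕ) := by
      field_simp
    rw [hd]
    field_simp
    rw [← neg_sub (ζ ^ (k : ℕ)) (ζ ^ (j : ℕ))]
    field_simp
    ring

/-- The vectors `(ζ ^ (k * m))ₖ` are eigenvectors of the matrix `[2 / (1 - ζ ^ (j - k))]`. -/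
lemma IsPrimitiveRoot.sum_pow_mul_div_pow_sub_pow {n : ℕ} {ζ : ℂ} (hζ : IsPrimitiveRoot ζ n)
    (j : Fin n) (m : ℕ) (hm : m < n) :
    2 * ∑ k : Fin n, (if j = k then (0 : ℂ) else ζ ^ (k : ℕ) / (ζ ^ (k : ℕ) - ζ ^ (j : ℕ))) *
      (ζ ^ (k : ℕ)) ^ m = (n - 1 - 2 * m) * (ζ ^ (j : ℕ)) ^ m := by
  induction m with
  | zero => simpa using hζ.sum_div_pow_sub_pow j
  | succ m ih =>
    have hgeom : ∑ k : Fin n, (ζ ^ (k : ℕ)) ^ (m + 1) = 0 := by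
      have hne : ζ ^ (m + 1) ≠ 1 := hζ.pow_ne_one_of_pos_of_lt (Nat.succ_ne_zero m) hm
      simp_rw [← pow_mul, mul_comm _ (m + 1), pow_mul]
      rw [Fin.sum_univ_eq_sum_range (fun k => (ζ ^ (m + 1)) ^ k), geom_sum_eq hne, ← pow_mul,
        mul_comm, pow_mul, hζ.pow_eq_one]
      simp
    have hstep : ∑ k : Fin n,
        (if j = k then (0 : ℂ) else ζ ^ (k : ℕ) / (ζ ^ (k : ℕ) - ζ ^ (j : ℕ))) *
          (ζ ^ (k : ℕ)) ^ (m + 1) =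
        ∑ k : Fin n, (ζ ^ (j : ℕ) *
          ((if j = k then (0 : ℂ) else ζ ^ (k : ℕ) / (ζ ^ (k : ℕ) - ζ ^ (j : ℕ))) *
            (ζ ^ (k : ℕ)) ^ m) + (ζ ^ (k : ℕ)) ^ (m + 1) -
          if j = k then (ζ ^ (j : ℕ)) ^ (m + 1) else 0) := by
      refine Finset.sum_congr rfl fun k _ => ?_
      by_cases hjk : j = k
      · simp [hjk]
      · have hne : ζ ^ (k : ℕ) - ζ ^ (j : ℕ) ≠ 0 :=
          sub_ne_zero.2 fun h => hjk (hζ.pow_fin_val_injective h).symm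
        simp only [if_neg hjk]
        generalize ζ ^ (k : ℕ) = a at *
        generalize ζ ^ (j : ℕ) = b at *
        field_simp
        ring
    rw [hstep, Finset.sum_sub_distrib, Finset.sum_add_distrib, hgeom, ← Finset.mul_sum,
      Finset.sum_ite_eq, if_pos (Finset.mem_univ j)]
    push_cast
    linear_combination ζ ^ (j : ℕ) * ih (by omega)

theorem stmt_12 (n : ℕ) (hn : 2 ≤ n) (ζ : ℂ) (hζ : IsPrimitiveRoot ζ n)
    (x : ℂ) :
    Matrix.det (x • (1 : Matrix (Fin n) (Fin n) ℂ) -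
      Matrix.of fun j k : Fin n =>
        2 * (if j = k then (0 : ℂ) else 1 / (1 - ζ ^ ((j : ℤ) - (k : ℤ))))) =
    ∏ s ∈ Finset.Icc 1 n, (x - (2 * (s : ℂ) - (n : ℂ) - 1)) := by
  have h0 : ζ ≠ 0 := hζ.ne_zero (by omega)
  set V := Matrix.vandermonde fun k : Fin n => ζ ^ (k : ℕ) with hV
  have hdet : V.det ≠ 0 := Matrix.det_vandermonde_ne_zero_iff.2 hζ.pow_fin_val_injective
  have hmul : (x • (1 : Matrix (Fin n) (Fin n) ℂ) - Matrix.of fun j k : Fin n =>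
        2 * (if j = k then (0 : ℂ) else 1 / (1 - ζ ^ ((j : ℤ) - (k : ℤ))))) * V =
      V * Matrix.diagonal fun m : Fin n => x - (n - 1 - 2 * ((m : ℕ) : ℂ)) := by
    ext j m
    rw [Matrix.mul_diagonal, sub_mul, Matrix.smul_mul, one_mul, Matrix.sub_apply,
      Matrix.smul_apply, Matrix.mul_apply]
    have hentry : ∀ k : Fin n, (if j = k then (0 : ℂ) else 1 / (1 - ζ ^ ((j : ℤ) - (k : ℤ)))) =
        if j = k then (0 : ℂ) else ζ ^ (k : ℕ) / (ζ ^ (k : ℕ) - ζ ^ (j : ℕ)) := fun k => by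
      have hk : ζ ^ (k : ℕ) ≠ 0 := pow_ne_zero _ h0
      rw [zpow_sub₀ h0, zpow_natCast, zpow_natCast, one_sub_div hk, one_div_div]
    simp only [Matrix.of_apply, hV, Matrix.vandermonde_apply, smul_eq_mul, hentry, mul_assoc,
      ← Finset.mul_sum]
    rw [hζ.sum_pow_mul_div_pow_sub_pow j m m.2]
    ring
  have hprod := congrArg Matrix.det hmul
  rw [Matrix.det_mul, Matrix.det_mul, mul_comm, Matrix.det_diagonal] at hprod
  rw [mul_left_cancel₀ hdet hprod,
    Fin.prod_univ_eq_prod_range (fun m => x - ((n : ℂ) - 1 - 2 * (m : ℂ))),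
    ← Finset.prod_range_reflect, Finset.range_eq_Ico, ← Finset.Ico_add_one_right_eq_Icc,
    ← Finset.prod_Ico_add' _ 0 n 1]
  refine Finset.prod_congr rfl fun m hm => ?_
  have hm' : m + 1 ≤ n := (Finset.mem_Ico.1 hm).2
  rw [Nat.sub_sub, add_comm 1 m, Nat.cast_sub hm']
  push_cast
  ring
end

section
/- Let n > 1 be an odd integer, and let ζ ∈ ℂ be a primitive n-th root of unity. For j, k = 1, ..., n define b_{jk} = (1 + ζ^{j-k})/(1 - ζ^{j-k}) if j ≠ k, and b_{jj} = 1. Then det(x I_n - [b_{jk}]_{1 ≤ j,k ≤ n}) = (x - 1) ∏_{s=1}^{n-1} (x - (n + 1 - 2s)) as polynomials in x; that is, the eigenvalues of the n × n matrix [b_{jk}]_{1 ≤ j,k ≤ n} are n + 1 - 2s for s = 1, ..., n-1, together with 1. -/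
theorem IsPrimitiveRoot.sum_fin_pow_pow_eq_zero {n : ℕ} {ζ : ℂ} (hζ : IsPrimitiveRoot ζ n)
    {r : ℕ} (hr : 0 < r) (hrn : r < n) : ∑ k : Fin n, (ζ ^ (k : ℕ)) ^ r = 0 := by
  have hne : ζ ^ r ≠ 1 := hζ.pow_ne_one_of_pos_of_lt hr.ne' hrn
  rw [Fin.sum_univ_eq_sum_range (fun k => (ζ ^ k) ^ r) n]
  simp_rw [pow_right_comm]
  rw [geom_sum_eq hne, ← pow_mul, mul_comm, pow_mul, hζ.pow_eq_one]
  simp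

theorem IsPrimitiveRoot.sum_fin_cayley_eq_zero {n : ℕ} {ζ : ℂ} (hζ : IsPrimitiveRoot ζ n)
    (j : Fin n) :
    ∑ k : Fin n, (ζ ^ (k : ℕ) + ζ ^ (j : ℕ)) / (ζ ^ (k : ℕ) - ζ ^ (j : ℕ)) = 0 := by
  have : NeZero n := ⟨(Fin.pos j).ne'⟩
  have h0 : ζ ≠ 0 := hζ.ne_zero (NeZero.ne n)
  have hadd (a b : Fin n) : ζ ^ ((a + b : Fin n) : ℕ) = ζ ^ (a : ℕ) * ζ ^ (b : ℕ) := by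
    rw [Fin.val_add, ← pow_add, ← pow_mod_orderOf ζ (a + b), ← hζ.eq_orderOf]
  have hneg := Equiv.sum_comp (Equiv.subLeft (j + j))
    (fun k : Fin n => (ζ ^ (k : ℕ) + ζ ^ (j : ℕ)) / (ζ ^ (k : ℕ) - ζ ^ (j : ℕ)))
  have hterm (k : Fin n) :
      (ζ ^ ((Equiv.subLeft (j + j) k : Fin n) : ℕ) + ζ ^ (j : ℕ)) /
        (ζ ^ ((Equiv.subLeft (j + j) k : Fin n) : ℕ) - ζ ^ (j : ℕ)) =
      -((ζ ^ (k : ℕ) + ζ ^ (j : ℕ)) / (ζ ^ (k : ℕ) - ζ ^ (j : ℕ))) := by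
    have hk : ζ ^ (k : ℕ) ≠ 0 := pow_ne_zero _ h0
    have hj : ζ ^ (j : ℕ) ≠ 0 := pow_ne_zero _ h0
    have h : ζ ^ ((Equiv.subLeft (j + j) k : Fin n) : ℕ) =
        ζ ^ (j : ℕ) * ζ ^ (j : ℕ) / ζ ^ (k : ℕ) := by
      rw [eq_div_iff hk, ← hadd, ← hadd]
      simp
    rw [h, ← mul_div_mul_right _ _ hk, add_mul, sub_mul, div_mul_cancel₀ _ hk, ← mul_add,
      ← mul_sub, mul_div_mul_left _ _ hj, ← div_neg, neg_sub, add_comm]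
  simp_rw [hterm, Finset.sum_neg_distrib] at hneg
  exact self_eq_neg.mp hneg.symm

theorem IsPrimitiveRoot.sum_fin_cayley_mul_pow {n : ℕ} {ζ : ℂ} (hζ : IsPrimitiveRoot ζ n)
    (j : Fin n) (r : ℕ) (hr : r < n) :
    ∑ k : Fin n, (ζ ^ (k : ℕ) + ζ ^ (j : ℕ)) / (ζ ^ (k : ℕ) - ζ ^ (j : ℕ)) * (ζ ^ (k : ℕ)) ^ r =
      (if r = 0 then 0 else (n : ℂ) - 2 * r) * (ζ ^ (j : ℕ)) ^ r := by
  induction r with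
  | zero => simpa using hζ.sum_fin_cayley_eq_zero j
  | succ r ih =>
    have hterm (k : Fin n) :
        (ζ ^ (k : ℕ) + ζ ^ (j : ℕ)) / (ζ ^ (k : ℕ) - ζ ^ (j : ℕ)) * (ζ ^ (k : ℕ)) ^ (r + 1) =
        ζ ^ (j : ℕ) * ((ζ ^ (k : ℕ) + ζ ^ (j : ℕ)) / (ζ ^ (k : ℕ) - ζ ^ (j : ℕ)) *
          (ζ ^ (k : ℕ)) ^ r) + ((ζ ^ (k : ℕ)) ^ (r + 1) + ζ ^ (j : ℕ) * (ζ ^ (k : ℕ)) ^ r) -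
          if k = j then 2 * (ζ ^ (j : ℕ)) ^ (r + 1) else 0 := by
      split_ifs with h
      · subst h
        simp
        ring
      · have hne : ζ ^ (k : ℕ) - ζ ^ (j : ℕ) ≠ 0 :=
          sub_ne_zero.mpr fun e => h (Fin.ext (hζ.pow_inj k.2 j.2 e))
        field_simp
        ring
    simp_rw [hterm]
    rw [Finset.sum_sub_distrib, Finset.sum_add_distrib, Finset.sum_add_distrib,
      ← Finset.mul_sum, ← Finset.mul_sum, ih (by lia), Finset.sum_ite_eq' Finset.univ j,
      hζ.sum_fin_pow_pow_eq_zero r.succ_pos hr]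
    rcases Nat.eq_zero_or_pos r with rfl | hr0
    · simp
      ring
    · rw [hζ.sum_fin_pow_pow_eq_zero hr0 (by lia)]
      simp [hr0.ne']
      ring

theorem stmt_14 (n : ℕ) (hn : 1 < n) (hodd : Odd n) (ζ : ℂ)
    (hζ : IsPrimitiveRoot ζ n) (x : ℂ) :
    Matrix.det (x • (1 : Matrix (Fin n) (Fin n) ℂ) -
      Matrix.of fun j k : Fin n =>
        if j = k then (1 : ℂ) else
          (1 + ζ ^ ((j : ℤ) - (k : ℤ))) / (1 - ζ ^ ((j : ℤ) - (k : ℤ)))) =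
    (x - 1) * ∏ s ∈ Finset.Icc 1 (n - 1), (x - ((n : ℂ) + 1 - 2 * s)) := by
  have h0 : ζ ≠ 0 := hζ.ne_zero (by lia)
  set B : Matrix (Fin n) (Fin n) ℂ := Matrix.of fun j k : Fin n =>
    if j = k then (1 : ℂ) else
      (1 + ζ ^ ((j : ℤ) - (k : ℤ))) / (1 - ζ ^ ((j : ℤ) - (k : ℤ))) with hB
  have hentry (j k : Fin n) : B j k = (if j = k then 1 else 0) +
      (ζ ^ (k : ℕ) + ζ ^ (j : ℕ)) / (ζ ^ (k : ℕ) - ζ ^ (j : ℕ)) := by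
    rw [hB, Matrix.of_apply]
    split_ifs with h
    · simp [h]
    · have hk : ζ ^ (k : ℕ) ≠ 0 := pow_ne_zero _ h0
      rw [zpow_sub₀ h0, zpow_natCast, zpow_natCast, ← mul_div_mul_right _ _ hk, add_mul, sub_mul,
        div_mul_cancel₀ _ hk, one_mul, zero_add]
  let V : Matrix (Fin n) (Fin n) ℂ := Matrix.vandermonde fun k : Fin n => ζ ^ (k : ℕ)
  let μ : ℕ → ℂ := fun r => 1 + if r = 0 then 0 else (n : ℂ) - 2 * r
  have hV : V.det ≠ 0 := Matrix.det_vandermonde_ne_zero_iff.mpr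
    fun a b e => Fin.ext (hζ.pow_inj a.2 b.2 e)
  have hmul : (x • (1 : Matrix (Fin n) (Fin n) ℂ) - B) * V =
      V * Matrix.diagonal fun r : Fin n => x - μ r := by
    have hBV : B * V = V * Matrix.diagonal fun r : Fin n => μ r := by
      ext j r
      rw [Matrix.mul_diagonal, Matrix.mul_apply]
      simp_rw [hentry, add_mul, Finset.sum_add_distrib, V, Matrix.vandermonde_apply]
      rw [hζ.sum_fin_cayley_mul_pow j r r.2]
      simp only [μ, ite_mul, one_mul, zero_mul, Finset.sum_ite_eq, Finset.mem_univ, if_true]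
      split_ifs <;> ring
    rw [sub_mul, hBV]
    ext j r
    simp [Matrix.mul_diagonal]
    ring
  have hdet := congrArg Matrix.det hmul
  rw [Matrix.det_mul, Matrix.det_mul, mul_comm] at hdet
  rw [mul_left_cancel₀ hV hdet, Matrix.det_diagonal,
    Fin.prod_univ_eq_prod_range (fun r => x - μ r) n]
  obtain ⟨m, rfl⟩ : ∃ m, n = m + 1 := ⟨n - 1, by lia⟩
  rw [Finset.prod_range_succ', mul_comm, Nat.add_sub_cancel, ← Finset.Ico_add_one_right_eq_Icc,
    Finset.prod_Ico_eq_prod_range, Nat.add_sub_cancel]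
  congr 1
  · simp [μ]
  · refine Finset.prod_congr rfl fun r _ => ?_
    simp [μ]
    ring
end

section
/- Let n > 1 be an odd integer, and let ζ ∈ ℂ be a primitive n-th root of unity. For j, k = 1, ..., n-1 define b_{jk} = (1 + ζ^{j-k})/(1 - ζ^{j-k}) if j ≠ k, and b_{jj} = 1. Then ∑_{τ ∈ D} sign(τ) ∏_{j=1}^{n-1} b_{j,τ(j)} taken over all permutations τ of {1, ..., n-1} — that is, det[b_{jk}]_{1 ≤ j,k ≤ n-1} — equals (-1)^{(n+1)/2} ((n-1)!!)^2 / (n(n-1)). -/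
open scoped Nat

/-- The eigenvalues of the `N × N` circulant matrix with diagonal entries `1` and off-diagonal
entries `(1 + ζ ^ (j - k)) / (1 - ζ ^ (j - k))`. -/
noncomputable def circulantSymbol (N m : ℕ) : ℂ := if m = 0 then 1 else N + 1 - 2 * m

theorem sub_one_mul_sum_natCast_mul_pow (z : ℂ) (N : ℕ) :
    (z - 1) * ∑ i ∈ Finset.range N, (i : ℂ) * z ^ i
      = N * z ^ N - z * ∑ i ∈ Finset.range N, z ^ i := by
  induction N with
  | zero => simp
  | succ k ih =>
    rw [Finset.sum_range_succ, Finset.sum_range_succ, mul_add, ih]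
    push_cast
    ring

theorem sum_circulantSymbol_mul_pow (z : ℂ) (N : ℕ) (hN : 0 < N) :
    ∑ m ∈ Finset.range N, circulantSymbol N m * z ^ m
      = (N + 1) * ∑ i ∈ Finset.range N, z ^ i
        - 2 * ∑ i ∈ Finset.range N, (i : ℂ) * z ^ i - N := by
  have h : ∀ m ∈ Finset.range N, circulantSymbol N m * z ^ m
      = ((N + 1) * z ^ m - 2 * (m * z ^ m)) - if m = 0 then (N : ℂ) else 0 := by
    intro m _
    unfold circulantSymbol
    split_ifs with h
    · subst h; simp
    · ring
  rw [Finset.sum_congr rfl h, Finset.sum_sub_distrib, Finset.sum_sub_distrib,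
    ← Finset.mul_sum, ← Finset.mul_sum, Finset.sum_ite_eq' (Finset.range N) 0]
  simp [hN]

theorem sum_circulantSymbol (N : ℕ) (hN : 0 < N) :
    ∑ m ∈ Finset.range N, circulantSymbol N m = N := by
  have h := sum_circulantSymbol_mul_pow 1 N hN
  have h2 : (∑ i ∈ Finset.range N, (i : ℂ)) * 2 = N * (N - 1) := by
    have := congrArg (Nat.cast : ℕ → ℂ) (Finset.sum_range_id_mul_two N)
    push_cast [Nat.cast_sub hN] at this
    simpa using this
  simp only [one_pow, mul_one, Finset.sum_const, Finset.card_range, nsmul_eq_mul] at h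
  rw [h]
  linear_combination -h2

theorem sum_circulantSymbol_mul_pow_of_pow_eq_one {z : ℂ} {N : ℕ} (hN : 0 < N) (hz : z ^ N = 1)
    (hz1 : z ≠ 1) :
    ∑ m ∈ Finset.range N, circulantSymbol N m * z ^ m = N * ((1 + z) / (1 - z)) := by
  have hz1' : 1 - z ≠ 0 := sub_ne_zero.mpr hz1.symm
  have hg : ∑ i ∈ Finset.range N, z ^ i = 0 := by
    rw [geom_sum_eq hz1, hz]; simp
  have h := sub_one_mul_sum_natCast_mul_pow z N
  rw [sum_circulantSymbol_mul_pow z N hN, hg]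
  rw [hg, hz] at h
  field_simp
  linear_combination 2 * h

theorem prod_erase_circulantSymbol (r : ℕ) :
    ∏ m ∈ (Finset.range (2 * r + 3)).erase (r + 2), circulantSymbol (2 * r + 3) m
      = (-1) ^ r * 2 ^ (2 * r + 1) * (r + 1)! * r ! := by
  have h : (Finset.range (2 * r + 3)).erase (r + 2)
      = insert 0 (Finset.Ico 1 (r + 2) ∪ Finset.Ico (r + 3) (2 * r + 3)) := by
    ext x
    simp only [Finset.mem_erase, Finset.mem_range, Finset.mem_insert, Finset.mem_union,
      Finset.mem_Ico]
    omega
  have hd : Disjoint (Finset.Ico 1 (r + 2)) (Finset.Ico (r + 3) (2 * r + 3)) := by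
    rw [Finset.disjoint_left]
    intro x
    simp only [Finset.mem_Ico]
    omega
  have h1 : ∏ m ∈ Finset.Ico 1 (r + 2), circulantSymbol (2 * r + 3) m
      = 2 ^ (r + 1) * (r + 1)! := by
    rw [Finset.prod_Ico_eq_prod_range, ← Finset.prod_range_reflect,
      ← Finset.prod_range_add_one_eq_factorial]
    push_cast
    conv_rhs => rw [← Finset.card_range (r + 1), ← Finset.prod_const, Finset.card_range,
      ← Finset.prod_mul_distrib]
    refine Finset.prod_congr rfl fun i hi => ?_
    rw [Finset.mem_range] at hi
    obtain ⟨k, rfl⟩ : ∃ k, r = i + k := ⟨r - i, by omega⟩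
    rw [show 1 + (i + k - i) = k + 1 by omega, circulantSymbol, if_neg (by omega)]
    push_cast
    ring
  have h2 : ∏ m ∈ Finset.Ico (r + 3) (2 * r + 3), circulantSymbol (2 * r + 3) m
      = (-2) ^ r * r ! := by
    rw [Finset.prod_Ico_eq_prod_range, ← Finset.prod_range_add_one_eq_factorial]
    push_cast
    rw [show 2 * r - r = r by omega]
    conv_rhs => rw [← Finset.card_range r, ← Finset.prod_const, Finset.card_range,
      ← Finset.prod_mul_distrib]
    refine Finset.prod_congr rfl fun i _ => ?_
    rw [circulantSymbol, if_neg (by omega)]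
    push_cast
    ring
  rw [h, Finset.prod_insert (by simp), Finset.prod_union hd, h1, h2, circulantSymbol, if_pos rfl,
    neg_pow (2 : ℂ)]
  ring

/-- Entries of the adjugate of a diagonalized matrix. -/
theorem adjugate_mul_diagonal_mul_apply {ι R : Type*} [Fintype ι] [DecidableEq ι] [CommRing R]
    {F G : Matrix ι ι R} (h : F * G = 1) (d : ι → R) (i j : ι) :
    (F * Matrix.diagonal d * G).adjugate i j
      = ∑ m, F i m * (∏ l ∈ Finset.univ.erase m, d l) * G m j := by
  have hF : F.adjugate = F.det • G := by
    calc F.adjugate = F.adjugate * (F * G) := by rw [h, mul_one]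
      _ = F.det • G := by rw [← mul_assoc, Matrix.adjugate_mul]; simp
  have hG : G.adjugate = G.det • F := by
    calc G.adjugate = (F * G) * G.adjugate := by rw [h, one_mul]
      _ = G.det • F := by rw [mul_assoc, Matrix.mul_adjugate]; simp
  have hdet : G.det * F.det = 1 := by
    rw [mul_comm, ← Matrix.det_mul, h, Matrix.det_one]
  rw [Matrix.adjugate_mul_distrib, Matrix.adjugate_mul_distrib, hF, hG, Matrix.adjugate_diagonal,
    Matrix.mul_smul, Matrix.smul_mul, Matrix.mul_smul, smul_smul, hdet, one_smul,
    ← mul_assoc, Matrix.mul_apply]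
  simp [Matrix.mul_diagonal]

theorem stmt_15 (n : ℕ) (hn : 1 < n) (hodd : Odd n) (ζ : ℂ)
    (hζ : IsPrimitiveRoot ζ n) :
    Matrix.det (Matrix.of fun j k : Fin (n - 1) =>
      if j = k then (1 : ℂ) else
        (1 + ζ ^ ((j : ℤ) - (k : ℤ))) / (1 - ζ ^ ((j : ℤ) - (k : ℤ)))) =
    (-1) ^ ((n + 1) / 2) * ((n - 1)‼ : ℂ) ^ 2 / (n * (n - 1)) := by
  obtain ⟨r, rfl⟩ : ∃ r, n = 2 * r + 3 := by
    obtain ⟨k, rfl⟩ := hodd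
    exact ⟨k - 1, by omega⟩
  have hζ0 : ζ ≠ 0 := hζ.ne_zero (by omega)
  set N := 2 * r + 3 with hN
  have hN0 : (N : ℂ) ≠ 0 := by exact Nat.cast_ne_zero.mpr (by omega)
  let F : Matrix (Fin N) (Fin N) ℂ := Matrix.of fun j m => ζ ^ ((j : ℤ) * m)
  let G : Matrix (Fin N) (Fin N) ℂ := Matrix.of fun m k => ζ ^ (-((k : ℤ) * m)) / N
  let d : Fin N → ℂ := fun m => circulantSymbol N m
  let z : Fin N → Fin N → ℂ := fun j k => ζ ^ ((j : ℤ) - (k : ℤ))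
  have hFG : ∀ j m k, F j m * G m k = z j k ^ (m : ℕ) / N := by
    intro j m k
    simp only [F, G, z, Matrix.of_apply]
    rw [← mul_div_assoc, ← zpow_add₀ hζ0, ← zpow_natCast, ← zpow_mul]
    congr 2
    ring
  have hzN : ∀ j k, z j k ^ N = 1 := by
    intro j k
    simp only [z]
    rw [← zpow_natCast, ← zpow_mul, mul_comm, zpow_mul, zpow_natCast, hζ.pow_eq_one, one_zpow]
  have hz1 : ∀ j k, j ≠ k → z j k ≠ 1 := by
    intro j k hjk h
    apply hjk
    have h2 := (hζ.zpow_eq_one_iff_dvd _).1 h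
    have h3 := Int.eq_zero_of_abs_lt_dvd h2 (by rw [abs_lt]; omega)
    exact Fin.ext (by omega)
  have hinv : F * G = 1 := by
    ext j k
    rw [Matrix.mul_apply, Finset.sum_congr rfl fun m _ => hFG j m k, ← Finset.sum_div,
      Fin.sum_univ_eq_sum_range (fun m => z j k ^ m)]
    by_cases hjk : j = k
    · subst hjk
      simp [z, hN0]
    · rw [geom_sum_eq (hz1 j k hjk), hzN, Matrix.one_apply_ne hjk]
      simp
  have hM : F * Matrix.diagonal d * G = Matrix.of fun j k : Fin N =>
      if j = k then (1 : ℂ) else (1 + z j k) / (1 - z j k) := by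
    ext j k
    have hterm : ∀ m, (F * Matrix.diagonal d) j m * G m k
        = circulantSymbol N m * z j k ^ (m : ℕ) / N := by
      intro m
      rw [Matrix.mul_diagonal, mul_div_assoc, ← hFG]
      ring
    rw [Matrix.mul_apply, Finset.sum_congr rfl fun m _ => hterm m, ← Finset.sum_div,
      Fin.sum_univ_eq_sum_range (fun m => circulantSymbol N m * z j k ^ m), Matrix.of_apply]
    split_ifs with hjk
    · subst hjk
      simp [z, sum_circulantSymbol N (by omega), hN0]
    · rw [sum_circulantSymbol_mul_pow_of_pow_eq_one (by omega) (hzN j k) (hz1 j k hjk)]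
      field_simp
  let p : Fin N := ⟨r + 2, by omega⟩
  have hp : d p = 0 := by
    simp only [d, p, circulantSymbol, hN]
    push_cast
    ring
  have hadj := adjugate_mul_diagonal_mul_apply hinv d 0 0
  rw [Finset.sum_eq_single p ?_ (by simp)] at hadj
  swap
  · intro m _ hm
    rw [Finset.prod_eq_zero (Finset.mem_erase.mpr ⟨hm.symm, Finset.mem_univ p⟩) hp]
    simp
  have hprod : ∏ l ∈ Finset.univ.erase p, d l
      = (-1) ^ r * 2 ^ (2 * r + 1) * (r + 1)! * r ! := by
    rw [← prod_erase_circulantSymbol]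
    refine Finset.prod_bij (fun a _ => (a : ℕ)) ?_ ?_ ?_ ?_
    · intro a ha
      have := Finset.ne_of_mem_erase ha
      have h2 : (a : ℕ) ≠ r + 2 := fun h => this (Fin.ext h)
      simp [h2, ← hN]
    · intro a _ b _ h
      exact Fin.ext h
    · intro b hb
      rw [Finset.mem_erase, Finset.mem_range] at hb
      exact ⟨⟨b, hb.2⟩, by simp [p, hb.1], rfl⟩
    · intro a _
      rfl
  rw [hM, Matrix.adjugate_fin_succ_eq_det_submatrix, hprod] at hadj
  have hsub : (Matrix.of fun j k : Fin N =>
      if j = k then (1 : ℂ) else (1 + z j k) / (1 - z j k)).submatrix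
        (Fin.succAbove 0) (Fin.succAbove 0)
      = Matrix.of fun j k : Fin (2 * r + 2) => if j = k then (1 : ℂ) else
        (1 + ζ ^ ((j : ℤ) - (k : ℤ))) / (1 - ζ ^ ((j : ℤ) - (k : ℤ))) := by
    ext j k
    simp [z]
  rw [hsub] at hadj
  change Matrix.det (Matrix.of fun j k : Fin (2 * r + 2) => if j = k then (1 : ℂ) else
        (1 + ζ ^ ((j : ℤ) - (k : ℤ))) / (1 - ζ ^ ((j : ℤ) - (k : ℤ)))) = _
  have hdf : ((N - 1)‼ : ℂ) = 2 ^ (r + 1) * (r + 1)! := by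
    rw [show N - 1 = 2 * (r + 1) by omega, Nat.doubleFactorial_two_mul]
    push_cast
    ring
  have hFGp : F 0 p * G p 0 = 1 / N := by
    rw [hFG]; simp [z]
  have hr : (r : ℂ) + 1 ≠ 0 := by exact_mod_cast Nat.succ_ne_zero r
  have hN1 : (N : ℂ) - 1 = 2 * (r + 1) := by rw [hN]; push_cast; ring
  rw [hdf, hN1, show (N + 1) / 2 = r + 2 by omega]
  simp only [Fin.val_zero, add_zero, pow_zero, one_mul] at hadj
  rw [hadj, mul_right_comm, hFGp, Nat.factorial_succ]
  push_cast
  field_simp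
  ring
end
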